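/- There is a universal constant C such that the following holds. Let r ≥ 1, let G = (V,E) be a finite edge-weighted graph excluding K_{r+1} as a minor, and let Δ > 0. Then there is a probability distribution over partitions of V into clusters each of strong diameter at most Δ such that for every vertex z ∈ V and every 0 ≤ γ ≤ 1/r², the probability that the ball B_G(z, γΔ) is cut by the partition (i.e., not contained in a single cluster) is at most C·γr². -/

import Mathlib

open MeasureTheory Real ENNReal

namespace KPRpaper

variable {V : Type*}

/-- The total weight of a walk in an edge-weighted graph. -/
def walkWeight (w : V → V → ℝ) {G : SimpleGraph V} {x y : V} (p : G.Walk x y) : ℝ :=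
  (p.darts.map (fun d => w d.toProd.1 d.toProd.2)).sum

/-- Shortest-path distance between `x` and `y` using only walks whose vertices all
lie in the set `s` (`⊤` if there is no such walk). -/
noncomputable def dIn (G : SimpleGraph V) (w : V → V → ℝ) (s : Set V) (x y : V) : ℝ≥0∞ :=
  ⨅ p : {p : G.Walk x y // ∀ v ∈ p.support, v ∈ s}, ENNReal.ofReal (walkWeight w p.1)

/-- Shortest-path distance in the whole graph. -/
noncomputable def dG (G : SimpleGraph V) (w : V → V → ℝ) (x y : V) : ℝ≥0∞ :=
  dIn G w Set.univ x y

/-- Distance from a point to a set, within the vertex set `s`. -/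
noncomputable def dSet (G : SimpleGraph V) (w : V → V → ℝ) (s : Set V) (x : V) (A : Set V) :
    ℝ≥0∞ :=
  ⨅ a ∈ A, dIn G w s x a

/-- The ball of radius `ρ` around `z` in the shortest-path metric. -/
def gball (G : SimpleGraph V) (w : V → V → ℝ) (z : V) (ρ : ℝ) : Set V :=
  {v | dG G w z v ≤ ENNReal.ofReal ρ}

/-- The ball of radius `ρ` around the set `A`, inside the induced subgraph on `s`. -/
def gballIn (G : SimpleGraph V) (w : V → V → ℝ) (s A : Set V) (ρ : ℝ) : Set V :=
  {v | v ∈ s ∧ dSet G w s v A ≤ ENNReal.ofReal ρ}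

/-- `G` contains the complete graph `K_q` as a minor: there are `q` pairwise disjoint
nonempty vertex sets, each inducing a connected subgraph, with an edge between any two. -/
def HasCliqueMinor (G : SimpleGraph V) (q : ℕ) : Prop :=
  ∃ S : Fin q → Set V,
    (∀ i, (S i).Nonempty) ∧
    (∀ i, (G.induce (S i)).Connected) ∧
    (∀ i j, i ≠ j → Disjoint (S i) (S j)) ∧
    (∀ i j, i ≠ j → ∃ u ∈ S i, ∃ v ∈ S j, G.Adj u v)

/-- There is a walk from `x` to `y` all of whose vertices lie in `s`. -/
def ReachableIn (G : SimpleGraph V) (s : Set V) (x y : V) : Prop :=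
  ∃ p : G.Walk x y, ∀ v ∈ p.support, v ∈ s

section Metric

variable {G : SimpleGraph V} {w : V → V → ℝ} {s s' A : Set V} {x y z : V}

lemma walkWeight_cons {u v x : V} (h : G.Adj u v) (p : G.Walk v x) :
    walkWeight w (SimpleGraph.Walk.cons h p) = w u v + walkWeight w p := by
  simp [walkWeight]

lemma walkWeight_nil (u : V) :
    walkWeight w (SimpleGraph.Walk.nil : G.Walk u u) = 0 := by
  simp [walkWeight]

lemma walkWeight_append {u v x : V} (p : G.Walk u v) (q : G.Walk v x) :
    walkWeight w (p.append q) = walkWeight w p + walkWeight w q := by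
  simp [walkWeight, SimpleGraph.Walk.darts_append]

lemma walkWeight_reverse (hsymm : ∀ u v, w u v = w v u) {u v : V} (p : G.Walk u v) :
    walkWeight w p.reverse = walkWeight w p := by
  induction p with
  | nil => simp [walkWeight]
  | cons h p ih =>
    rw [SimpleGraph.Walk.reverse_cons, walkWeight_append, ih, walkWeight_cons, walkWeight_cons,
      walkWeight_nil, hsymm]
    ring

lemma walkWeight_nonneg (hpos : ∀ u v, G.Adj u v → 0 < w u v) {u v : V} (p : G.Walk u v) :
    0 ≤ walkWeight w p := by
  induction p with
  | nil => simp [walkWeight]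
  | cons h p ih =>
    rw [walkWeight_cons]
    linarith [hpos _ _ h]

lemma dIn_le_of_walk (p : G.Walk x y) (hp : ∀ v ∈ p.support, v ∈ s) :
    dIn G w s x y ≤ ENNReal.ofReal (walkWeight w p) :=
  iInf_le (fun p : {p : G.Walk x y // ∀ v ∈ p.support, v ∈ s} =>
    ENNReal.ofReal (walkWeight w p.1)) ⟨p, hp⟩

lemma exists_walk_of_dIn_lt {c : ℝ≥0∞} (h : dIn G w s x y < c) :
    ∃ p : G.Walk x y, (∀ v ∈ p.support, v ∈ s) ∧ ENNReal.ofReal (walkWeight w p) < c := by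
  obtain ⟨⟨p, hp⟩, h⟩ := iInf_lt_iff.1 h
  exact ⟨p, hp, h⟩

lemma mem_left_of_dIn_lt_top (h : dIn G w s x y < ⊤) : x ∈ s := by
  obtain ⟨p, hp, -⟩ := exists_walk_of_dIn_lt h
  exact hp _ p.start_mem_support

lemma mem_right_of_dIn_lt_top (h : dIn G w s x y < ⊤) : y ∈ s := by
  obtain ⟨p, hp, -⟩ := exists_walk_of_dIn_lt h
  exact hp _ p.end_mem_support

lemma dIn_self (hx : x ∈ s) : dIn G w s x x = 0 := by
  have := dIn_le_of_walk (w := w) (G := G) (s := s) (SimpleGraph.Walk.nil : G.Walk x x)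
    (by simpa using hx)
  simpa [walkWeight_nil] using this

lemma dIn_mono (h : s ⊆ s') : dIn G w s' x y ≤ dIn G w s x y :=
  le_iInf fun p => dIn_le_of_walk p.1 fun v hv => h (p.2 v hv)

lemma dIn_comm (hsymm : ∀ u v, w u v = w v u) : dIn G w s x y = dIn G w s y x := by
  have key : ∀ x y, dIn G w s x y ≤ dIn G w s y x := fun x y => by
    refine le_iInf fun p => ?_
    rw [← walkWeight_reverse hsymm]
    exact dIn_le_of_walk _ (by simpa using p.2)
  exact le_antisymm (key x y) (key y x)

lemma dIn_triangle (hpos : ∀ u v, G.Adj u v → 0 < w u v) :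
    dIn G w s x z ≤ dIn G w s x y + dIn G w s y z := by
  refine ENNReal.le_iInf_add_iInf ?_
  rintro ⟨p, hp⟩ ⟨q, hq⟩
  refine (dIn_le_of_walk (p.append q) ?_).trans ?_
  · intro v hv
    rcases SimpleGraph.Walk.mem_support_append_iff _ _ |>.1 hv with h | h
    exacts [hp _ h, hq _ h]
  · rw [walkWeight_append, ENNReal.ofReal_add (walkWeight_nonneg hpos p)
      (walkWeight_nonneg hpos q)]

lemma dIn_le_of_adj (hpos : ∀ u v, G.Adj u v → 0 < w u v) (hx : x ∈ s) (h : G.Adj x y) :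
    dIn G w s x z ≤ ENNReal.ofReal (w x y) + dIn G w s y z := by
  by_cases hy : y ∈ s
  · refine (dIn_triangle hpos (y := y)).trans ?_
    gcongr
    have := dIn_le_of_walk (w := w) (G := G) (s := s) (SimpleGraph.Walk.cons h .nil)
      (by simp [hx, hy])
    simpa [walkWeight_cons, walkWeight_nil] using this
  · have : dIn G w s y z = ⊤ := by
      by_contra h
      exact hy (mem_left_of_dIn_lt_top (lt_top_iff_ne_top.2 h))
    simp [this]

lemma dSet_singleton (a : V) : dSet G w s x {a} = dIn G w s x a := by
  simp [dSet]

lemma dSet_le {a : V} (ha : a ∈ A) : dSet G w s x A ≤ dIn G w s x a :=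
  iInf₂_le a ha

lemma exists_of_dSet_lt {c : ℝ≥0∞} (h : dSet G w s x A < c) : ∃ a ∈ A, dIn G w s x a < c := by
  simpa [dSet, iInf_lt_iff] using h

lemma mem_of_dSet_lt_top (h : dSet G w s x A < ⊤) : x ∈ s := by
  obtain ⟨a, -, h⟩ := exists_of_dSet_lt h
  exact mem_left_of_dIn_lt_top h

lemma dSet_triangle (hpos : ∀ u v, G.Adj u v → 0 < w u v) :
    dSet G w s x A ≤ dIn G w s x y + dSet G w s y A := by
  rw [dSet, dSet, ENNReal.add_iInf]
  refine le_iInf fun a => ?_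
  rw [ENNReal.add_iInf]
  by_cases ha : a ∈ A
  · refine le_iInf fun _ => (dSet_le ha).trans (dIn_triangle hpos)
  · refine le_iInf fun h => absurd h ha

lemma dSet_le_of_adj (hpos : ∀ u v, G.Adj u v → 0 < w u v) (hx : x ∈ s) (h : G.Adj x y) :
    dSet G w s x A ≤ ENNReal.ofReal (w x y) + dSet G w s y A := by
  rw [dSet, dSet, ENNReal.add_iInf]
  refine le_iInf fun a => ?_
  rw [ENNReal.add_iInf]
  refine le_iInf fun ha => (dSet_le ha).trans (dIn_le_of_adj hpos hx h)

lemma dSet_self (hx : x ∈ s) (hA : x ∈ A) : dSet G w s x A = 0 :=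
  le_antisymm ((dSet_le hA).trans (dIn_self hx).le) bot_le

/-- A vertex outside the target set, at finite distance from it, has a neighbour which is the
next vertex of a shortest path to the target set. -/
lemma exists_adj_dSet_eq [Finite V] (hpos : ∀ u v, G.Adj u v → 0 < w u v)
    (hx : dSet G w s x A < ⊤) (hxA : x ∉ A) :
    ∃ y ∈ s, G.Adj x y ∧ dSet G w s x A = ENNReal.ofReal (w x y) + dSet G w s y A := by
  have hxs := mem_of_dSet_lt_top hx
  have step : ∀ a ∈ A, ∀ p : G.Walk x a, (∀ v ∈ p.support, v ∈ s) → ∃ y ∈ s, G.Adj x y ∧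
      ENNReal.ofReal (w x y) + dSet G w s y A ≤ ENNReal.ofReal (walkWeight w p) := by
    intro a ha p hp
    cases p with
    | nil => exact absurd ha hxA
    | @cons _ v _ h p =>
      have hp' : ∀ u ∈ p.support, u ∈ s := fun u hu => hp u (by simp [hu])
      refine ⟨v, hp' _ p.start_mem_support, h, ?_⟩
      rw [walkWeight_cons, ENNReal.ofReal_add (hpos _ _ h).le (walkWeight_nonneg hpos p)]
      gcongr
      exact (dSet_le ha).trans (dIn_le_of_walk p hp')
  have hne : {y | y ∈ s ∧ G.Adj x y}.Nonempty := by
    obtain ⟨a, ha, h⟩ := exists_of_dSet_lt hx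
    obtain ⟨p, hp, -⟩ := exists_walk_of_dIn_lt h
    obtain ⟨y, hy, hxy, -⟩ := step a ha p hp
    exact ⟨y, hy, hxy⟩
  obtain ⟨y, ⟨hy, hxy⟩, hmin⟩ := Set.exists_min_image _
    (fun y => ENNReal.ofReal (w x y) + dSet G w s y A) (Set.toFinite _) hne
  refine ⟨y, hy, hxy, le_antisymm (dSet_le_of_adj hpos hxs hxy) ?_⟩
  refine le_iInf₂ fun a ha => le_iInf fun p => ?_
  obtain ⟨y', hy', hxy', h⟩ := step a ha p.1 p.2
  exact (hmin y' ⟨hy', hxy'⟩).trans h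

/-- Induction along shortest paths towards the set `A`. -/
lemma dSet_induction [Finite V] (hpos : ∀ u v, G.Adj u v → 0 < w u v) {P : V → Prop}
    (base : ∀ a ∈ A, a ∈ s → P a)
    (step : ∀ x y, x ∈ s → y ∈ s → x ∉ A → G.Adj x y → dSet G w s y A < ⊤ →
      dSet G w s x A = ENNReal.ofReal (w x y) + dSet G w s y A → P y → P x)
    (hx : dSet G w s x A < ⊤) : P x := by
  have wf : WellFounded fun u v : V => dSet G w s u A < dSet G w s v A :=
    @Finite.wellFounded_of_trans_of_irrefl _ _ _ ⟨fun _ _ _ h h' => lt_trans h h'⟩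
      ⟨fun _ => lt_irrefl _⟩
  induction x using wf.induction with
  | _ x ih =>
    have hxs := mem_of_dSet_lt_top hx
    by_cases hxA : x ∈ A
    · exact base x hxA hxs
    · obtain ⟨y, hy, hxy, h⟩ := exists_adj_dSet_eq hpos hx hxA
      have hyt : dSet G w s y A < ⊤ := lt_of_le_of_lt (by rw [h]; exact le_add_self) hx
      have hlt : dSet G w s y A < dSet G w s x A := by
        rw [h, add_comm]
        exact ENNReal.lt_add_right hyt.ne (by simpa using hpos _ _ hxy)
      exact step x y hxs hy hxA hxy hyt h (ih y hlt hyt)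

/-- If the part of `s` that is at most as far from `x` as `y` lies in `s'`, then the distance
from `x` to `y` does not increase when passing from `s` to `s'`. -/
lemma dIn_le_of_local [Finite V] (hpos : ∀ u v, G.Adj u v → 0 < w u v)
    (hsymm : ∀ u v, w u v = w v u) (hy : dIn G w s x y < ⊤)
    (hloc : ∀ v, dIn G w s x v ≤ dIn G w s x y → v ∈ s') :
    dIn G w s' x y ≤ dIn G w s x y := by
  rw [dIn_comm hsymm] at hy ⊢
  rw [dIn_comm hsymm (s := s)] at hloc ⊢
  rw [← dSet_singleton] at hy
  revert hloc
  refine dSet_induction (s := s) (A := {x})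
    (P := fun y => (∀ v, dIn G w s x v ≤ dIn G w s y x → v ∈ s') →
      dIn G w s' y x ≤ dIn G w s y x) hpos ?_ ?_ hy
  · rintro a rfl has h
    rw [dIn_self (h a (by simp [dIn_self has]))]
    exact bot_le
  · intro u v hu hv hux huv hvt h ih hloc
    rw [dSet_singleton, dSet_singleton] at h
    have hle : dIn G w s v x ≤ dIn G w s u x := by rw [h]; exact le_add_self
    refine (dIn_le_of_adj hpos (hloc u (by rw [dIn_comm hsymm])) huv).trans ?_
    rw [h]
    gcongr
    exact ih fun a ha => hloc a (ha.trans hle)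

/-- A neighbourhood of `A` inside `s` contains the shortest paths from its points to `A`. -/
lemma exists_dIn_le_of_dSet_le [Finite V] (hpos : ∀ u v, G.Adj u v → 0 < w u v) {c : ℝ≥0∞}
    (hc : c < ⊤) (hx : dSet G w s x A ≤ c) :
    ∃ a ∈ A, dIn G w {v | v ∈ s ∧ dSet G w s v A ≤ c} x a ≤ dSet G w s x A := by
  revert hx
  intro hx
  have hxt := hx.trans_lt hc
  revert hx
  refine dSet_induction (s := s) (A := A) (P := fun x => dSet G w s x A ≤ c →
    ∃ a ∈ A, dIn G w {v | v ∈ s ∧ dSet G w s v A ≤ c} x a ≤ dSet G w s x A) hpos ?_ ?_ hxt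
  · intro a ha has h
    exact ⟨a, ha, (dIn_self (s := {v | v ∈ s ∧ dSet G w s v A ≤ c}) ⟨has, h⟩).le.trans bot_le⟩
  · intro u v hu hv huA huv hvt h ih hle
    obtain ⟨a, ha, hva⟩ := ih (le_trans (by rw [h]; exact le_add_self) hle)
    refine ⟨a, ha, (dIn_le_of_adj hpos (s := {v | v ∈ s ∧ dSet G w s v A ≤ c})
      ⟨hu, hle⟩ huv).trans ?_⟩
    rw [h]
    gcongr

/-- A shortest path from a point outside the `c`-neighbourhood of `A` to `A` leaves the
complement of that neighbourhood at a vertex adjacent to it. -/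
lemma exists_adj_of_lt_dSet [Finite V] (hpos : ∀ u v, G.Adj u v → 0 < w u v) {c : ℝ≥0∞}
    (hx : c < dSet G w s x A) (hxt : dSet G w s x A < ⊤) :
    ∃ u, (∃ a, (a ∈ s ∧ dSet G w s a A ≤ c) ∧ G.Adj u a) ∧ c < dSet G w s u A ∧
      dIn G w (s \ {v | v ∈ s ∧ dSet G w s v A ≤ c}) x u + dSet G w s u A ≤ dSet G w s x A := by
  revert hx
  refine dSet_induction (s := s) (A := A) (P := fun x => c < dSet G w s x A →
    ∃ u, (∃ a, (a ∈ s ∧ dSet G w s a A ≤ c) ∧ G.Adj u a) ∧ c < dSet G w s u A ∧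
      dIn G w (s \ {v | v ∈ s ∧ dSet G w s v A ≤ c}) x u + dSet G w s u A ≤ dSet G w s x A)
    hpos ?_ ?_ hxt
  · intro a ha has h
    rw [dSet_self has ha] at h
    exact absurd h (by simp)
  · intro u v hu hv huA huv hvt h ih hlt
    have hu' : u ∈ s \ {v | v ∈ s ∧ dSet G w s v A ≤ c} := ⟨hu, fun h' => absurd h'.2 hlt.not_ge⟩
    by_cases hvc : dSet G w s v A ≤ c
    · refine ⟨u, ⟨v, ⟨hv, hvc⟩, huv⟩, hlt, ?_⟩
      rw [dIn_self hu', zero_add]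
    · obtain ⟨b, hb, hcb, hle⟩ := ih (not_le.1 hvc)
      refine ⟨b, hb, hcb, ?_⟩
      rw [h]
      calc _ ≤ (ENNReal.ofReal (w u v) + dIn G w (s \ {v | v ∈ s ∧ dSet G w s v A ≤ c}) v b)
            + dSet G w s b A := by
            gcongr
            exact dIn_le_of_adj hpos hu' huv
        _ ≤ _ := by
            rw [add_assoc]
            gcongr

/-- Existence of geodesics, described through the distance to their starting point. -/
lemma exists_geodesic [Finite V] (hpos : ∀ u v, G.Adj u v → 0 < w u v)
    (hsymm : ∀ u v, w u v = w v u) (hx : dIn G w s x z < ⊤) :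
    ∃ Q ⊆ s, z ∈ Q ∧ x ∈ Q ∧ (∀ u ∈ Q, dIn G w s u z < ⊤) ∧
      ∀ u ∈ Q, ∀ v ∈ Q, dIn G w s u z ≤ dIn G w s v z →
        dIn G w Q u v + dIn G w s u z ≤ dIn G w s v z := by
  rw [← dSet_singleton] at hx
  suffices h : ∃ Q ⊆ s, z ∈ Q ∧ x ∈ Q ∧ (∀ u ∈ Q, dIn G w s u z ≤ dIn G w s x z) ∧
      ∀ u ∈ Q, ∀ v ∈ Q, dIn G w s u z ≤ dIn G w s v z →
        dIn G w Q u v + dIn G w s u z ≤ dIn G w s v z by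
    obtain ⟨Q, h1, h2, h3, h4, h5⟩ := h
    rw [dSet_singleton] at hx
    exact ⟨Q, h1, h2, h3, fun u hu => (h4 u hu).trans_lt hx, h5⟩
  refine dSet_induction (s := s) (A := {z}) (P := fun x => ∃ Q ⊆ s, z ∈ Q ∧ x ∈ Q ∧
    (∀ u ∈ Q, dIn G w s u z ≤ dIn G w s x z) ∧ ∀ u ∈ Q, ∀ v ∈ Q,
      dIn G w s u z ≤ dIn G w s v z → dIn G w Q u v + dIn G w s u z ≤ dIn G w s v z)
    hpos ?_ ?_ hx
  · rintro a rfl ha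
    refine ⟨{a}, by simpa using ha, rfl, rfl, by simp, ?_⟩
    rintro u rfl v rfl -
    rw [dIn_self (Set.mem_singleton _)]
    simp
  · intro u v hu hv huz huv hvt h ⟨Q, hQs, hzQ, hvQ, hQv, hQ⟩
    rw [dSet_singleton, dSet_singleton] at h
    rw [dSet_singleton] at hvt
    have hlt : dIn G w s v z < dIn G w s u z := by
      rw [h, add_comm]
      exact ENNReal.lt_add_right hvt.ne (by simpa using hpos _ _ huv)
    refine ⟨insert u Q, Set.insert_subset hu hQs, Or.inr hzQ, Or.inl rfl, ?_, ?_⟩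
    · rintro a (rfl | ha)
      exacts [le_rfl, (hQv a ha).trans hlt.le]
    · rintro a (rfl | ha) b (rfl | hb) hab
      · rw [dIn_self (Set.mem_insert _ _), zero_add]
      · exact absurd (hab.trans (hQv b hb)) hlt.not_ge
      · have h1 : dIn G w (insert b Q) b a ≤ ENNReal.ofReal (w b v) + dIn G w (insert b Q) v a :=
          dIn_le_of_adj hpos (Set.mem_insert _ _) huv
        have h2 : dIn G w (insert b Q) a v ≤ dIn G w Q a v := dIn_mono (Set.subset_insert _ _)
        rw [dIn_comm hsymm, h]
        calc _ ≤ ENNReal.ofReal (w b v) + dIn G w Q a v + dIn G w s a z := by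
              gcongr
              refine h1.trans ?_
              rw [dIn_comm hsymm]
              gcongr
          _ ≤ _ := by
              rw [add_assoc]
              gcongr
              exact hQ a ha v hvQ (hQv a ha)
      · exact (add_le_add_left (dIn_mono (Set.subset_insert _ _)) _).trans (hQ a ha b hb hab)

lemma induce_connected_of_dIn_lt_top {t : V} (hs : ∀ v ∈ s, dIn G w s v t < ⊤)
    (ht : t ∈ s) : (G.induce s).Connected := by
  have : Nonempty s := ⟨⟨t, ht⟩⟩
  have key : ∀ v : s, (G.induce s).Reachable v ⟨t, ht⟩ := by
    rintro ⟨v, hv⟩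
    obtain ⟨p, hp, -⟩ := exists_walk_of_dIn_lt (hs v hv)
    exact ⟨p.induce s hp⟩
  exact ⟨fun u v => (key u).trans (key v).symm⟩

end Metric

section Potential

/-- The summands of the potential `potential q X`. -/
noncomputable def potentialTerm (q : ℝ) (X : Finset ℕ) (t : ℕ) : ℝ :=
  2 * (1 - q) * q ^ t * (1 / 2) ^ (X.filter (· ≤ t)).card

/-- A potential that controls how often a vertex can be threatened by new clusters, given the
(discretised) distances `X` to the earlier clusters which are still adjacent to its component. -/
noncomputable def potential (q : ℝ) (X : Finset ℕ) : ℝ := ∑' t, potentialTerm q X t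

/-- The distances that are kept after a new cluster at distance `y` has been carved out. -/
def insertBelow (X : Finset ℕ) (y : ℕ) : Finset ℕ := insert y (X.filter (· < y))

variable {q β : ℝ} {X : Finset ℕ}

lemma potentialTerm_nonneg (h0 : 0 ≤ q) (h1 : q ≤ 1) (X : Finset ℕ) (t : ℕ) :
    0 ≤ potentialTerm q X t := by
  have : 0 ≤ 1 - q := by linarith
  unfold potentialTerm
  positivity

lemma potentialTerm_le (h0 : 0 ≤ q) (h1 : q ≤ 1) (X : Finset ℕ) (t : ℕ) :
    potentialTerm q X t ≤ 2 * (1 - q) * q ^ t := by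
  have : 0 ≤ 1 - q := by linarith
  unfold potentialTerm
  exact mul_le_of_le_one_right (by positivity) (pow_le_one₀ (by norm_num) (by norm_num))

lemma hasSum_geometric_tail (h0 : 0 ≤ q) (h1 : q < 1) (T : ℕ) :
    HasSum (fun t => 2 * (1 - q) * q ^ (t + T)) (2 * q ^ T) := by
  have h := (hasSum_geometric_of_lt_one h0 h1).mul_left (2 * (1 - q) * q ^ T)
  have h2 : 2 * (1 - q) * q ^ T * (1 - q)⁻¹ = 2 * q ^ T := by
    have : 1 - q ≠ 0 := by linarith
    field_simp
  rw [h2] at h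
  refine h.congr_fun fun t => ?_
  rw [pow_add]
  ring

lemma summable_potentialTerm (h0 : 0 ≤ q) (h1 : q < 1) (X : Finset ℕ) :
    Summable (potentialTerm q X) :=
  Summable.of_nonneg_of_le (potentialTerm_nonneg h0 h1.le X) (potentialTerm_le h0 h1.le X)
    (by simpa using (hasSum_geometric_tail h0 h1 0).summable)

lemma potential_nonneg (h0 : 0 ≤ q) (h1 : q ≤ 1) (X : Finset ℕ) : 0 ≤ potential q X :=
  tsum_nonneg (potentialTerm_nonneg h0 h1 X)

lemma potential_le_add (h0 : 0 ≤ q) (h1 : q < 1) (X : Finset ℕ) (T : ℕ) :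
    potential q X ≤ ∑ t ∈ Finset.range T, potentialTerm q X t + 2 * q ^ T := by
  rw [potential, ← (summable_potentialTerm h0 h1 X).sum_add_tsum_nat_add T]
  gcongr
  have h := hasSum_geometric_tail h0 h1 T
  rw [← h.tsum_eq]
  exact Summable.tsum_le_tsum (fun t => potentialTerm_le h0 h1.le X _)
    ((summable_nat_add_iff T).2 (summable_potentialTerm h0 h1 X)) h.summable

lemma add_le_potential (h0 : 0 ≤ q) (h1 : q < 1) {m : ℕ} (hX : X.card ≤ m) (T : ℕ) :
    ∑ t ∈ Finset.range T, potentialTerm q X t + 2 * q ^ T * (1 / 2) ^ m ≤ potential q X := by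
  rw [potential, ← (summable_potentialTerm h0 h1 X).sum_add_tsum_nat_add T]
  gcongr
  have h := (hasSum_geometric_tail h0 h1 T).mul_right ((1 / 2 : ℝ) ^ m)
  rw [← h.tsum_eq]
  refine Summable.tsum_le_tsum (fun t => ?_) h.summable
    ((summable_nat_add_iff T).2 (summable_potentialTerm h0 h1 X))
  have : 0 ≤ 1 - q := by linarith
  unfold potentialTerm
  exact mul_le_mul_of_nonneg_left (pow_le_pow_of_le_one (by norm_num) (by norm_num)
    ((Finset.card_filter_le _ _).trans hX)) (by positivity)

lemma potential_empty (h0 : 0 ≤ q) (h1 : q < 1) : potential q ∅ = 2 := by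
  have h := (hasSum_geometric_tail h0 h1 0).tsum_eq
  simpa [potential, potentialTerm] using h

lemma potential_insertBelow (h0 : 0 ≤ q) (h1 : q < 1) (X : Finset ℕ) (y : ℕ) :
    potential q (insertBelow X (y + 1)) =
      ∑ t ∈ Finset.range (y + 1), potentialTerm q X t
        + q ^ (y + 1) * (1 / 2) ^ (X.filter (· ≤ y)).card := by
  rw [potential, ← (summable_potentialTerm h0 h1 _).sum_add_tsum_nat_add (y + 1)]
  congr 1
  · refine Finset.sum_congr rfl fun t ht => ?_
    have ht : t < y + 1 := Finset.mem_range.1 ht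
    unfold potentialTerm insertBelow
    congr 3
    ext x
    simp only [Finset.mem_filter, Finset.mem_insert]
    grind
  · have h := (hasSum_geometric_tail h0 h1 (y + 1)).mul_right
      ((1 / 2 : ℝ) ^ ((X.filter (· ≤ y)).card + 1))
    have h2 : 2 * q ^ (y + 1) * (1 / 2) ^ ((X.filter (· ≤ y)).card + 1)
        = q ^ (y + 1) * (1 / 2) ^ (X.filter (· ≤ y)).card := by ring
    rw [h2] at h
    rw [← h.tsum_eq]
    refine tsum_congr fun t => ?_
    unfold potentialTerm insertBelow
    congr 2
    have : (insert (y + 1) (X.filter (· < y + 1))).filter (· ≤ t + (y + 1))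
        = insert (y + 1) (X.filter (· ≤ y)) := by
      ext x
      simp only [Finset.mem_filter, Finset.mem_insert]
      grind
    rw [this, Finset.card_insert_of_notMem (by simp)]

/-- The expected potential after a step with geometrically distributed radius telescopes. -/
lemma sum_geometric_mul_potential (hβ0 : 0 < β) (hβ1 : β < 1) (X : Finset ℕ) (D T : ℕ)
    (hT : T ≤ D) :
    ∑ J ∈ Finset.range T, (1 - β) * β ^ J * potential (2 * β / (1 + β)) (insertBelow X (D - J)) =
      ∑ t ∈ Finset.range D, potentialTerm (2 * β / (1 + β)) X t
        - β ^ T * ∑ t ∈ Finset.range (D - T), potentialTerm (2 * β / (1 + β)) X t := by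
  have h0 : 0 ≤ 2 * β / (1 + β) := by positivity
  have h1 : 2 * β / (1 + β) < 1 := by
    rw [div_lt_one (by linarith)]
    linarith
  induction T with
  | zero => simp
  | succ T ih =>
    rw [Finset.sum_range_succ, ih (by omega)]
    obtain ⟨y, hy⟩ : ∃ y, D - T = y + 1 := ⟨D - T - 1, by omega⟩
    have hy' : D - (T + 1) = y := by omega
    rw [hy, hy', potential_insertBelow h0 h1, Finset.sum_range_succ]
    have key : (1 - β) * (2 * β / (1 + β)) = β * (2 * (1 - 2 * β / (1 + β))) := by
      field_simp
      ring
    have hterm : (1 - β) * ((2 * β / (1 + β)) ^ (y + 1) * (1 / 2) ^ (X.filter (· ≤ y)).card)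
        = β * potentialTerm (2 * β / (1 + β)) X y := by
      unfold potentialTerm
      rw [pow_succ]
      linear_combination (2 * β / (1 + β)) ^ y * (1 / 2) ^ (X.filter (· ≤ y)).card * key
    linear_combination β ^ T * hterm

/-- The potential decreases in expectation. -/
lemma potential_drift (hβ0 : 0 < β) (hβ1 : β < 1) {m M : ℕ} (hX : X.card ≤ m)
    (hM : 2 * β ^ M ≤ (2 * β / (1 + β)) ^ M * (1 / 2) ^ m) (D : ℕ) :
    ∑ J ∈ Finset.range (min M D),
        (1 - β) * β ^ J * potential (2 * β / (1 + β)) (insertBelow X (D - J))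
      + (2 * β / (1 + β)) ^ D * (1 / 2) ^ m ≤ (1 - β ^ M) * potential (2 * β / (1 + β)) X := by
  set q := 2 * β / (1 + β) with hq
  have h0 : 0 ≤ q := by positivity
  have h1 : q < 1 := by
    rw [hq, div_lt_one (by linarith)]
    linarith
  rw [sum_geometric_mul_potential hβ0 hβ1 X D _ (min_le_right _ _), ← hq]
  have hD : β ^ min M D * ∑ t ∈ Finset.range (D - min M D), potentialTerm q X t
      = β ^ M * ∑ t ∈ Finset.range (D - M), potentialTerm q X t := by
    rcases le_total M D with h | h
    · rw [min_eq_left h]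
    · rw [min_eq_right h, Nat.sub_self, Nat.sub_eq_zero_of_le h]
      simp
  rw [hD]
  have hδ : 0 ≤ β ^ M := by positivity
  have e1 := add_le_potential h0 h1 hX D
  have e2 := mul_le_mul_of_nonneg_left (potential_le_add h0 h1 X (D - M)) hδ
  have e3 : 2 * β ^ M * q ^ (D - M) ≤ q ^ D * (1 / 2) ^ m := by
    calc 2 * β ^ M * q ^ (D - M) ≤ q ^ M * (1 / 2) ^ m * q ^ (D - M) := by gcongr
      _ = q ^ (M + (D - M)) * (1 / 2) ^ m := by rw [pow_add]; ring
      _ ≤ q ^ D * (1 / 2) ^ m := by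
        exact mul_le_mul_of_nonneg_right (pow_le_pow_of_le_one h0 h1.le (by omega))
          (by positivity)
  nlinarith

/-- The bound on the probability that a ball of radius `g` (in discrete units) is cut, in terms
of the current distances `X`; here `b` accounts for the subdivision of a single cluster. -/
noncomputable def cutBound (β : ℝ) (m M g : ℕ) (b : ℝ) (X : Finset ℕ) : ℝ :=
  b + 2 * g * (1 - β) * (1 + β ^ M / (1 - β ^ M) *
    (potential (2 * β / (1 + β)) X / ((2 * β / (1 + β)) ^ (M + g) * (1 / 2) ^ m)))

lemma cutBound_step (hβ0 : 0 < β) (hβ1 : β < 1) {m M g : ℕ} (hM0 : 0 < M) (hX : X.card ≤ m)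
    (hM : 2 * β ^ M ≤ (2 * β / (1 + β)) ^ M * (1 / 2) ^ m) {b : ℝ} (hb : 0 ≤ b) (D : ℕ)
    (c : ℕ → ℝ) (h1 : ∀ J < M, D + g ≤ J → c J ≤ b)
    (h2 : ∀ J < M, J + g < D → c J ≤ cutBound β m M g b (insertBelow X (D - J)))
    (h3 : ∀ J < M, c J ≤ 1) :
    ∑ J ∈ Finset.range M, (1 - β) * β ^ J / (1 - β ^ M) * c J ≤ cutBound β m M g b X := by
  have hδ0 : 0 < β ^ M := by positivity
  have hδ1 : 0 < 1 - β ^ M := by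
    have := pow_lt_one₀ hβ0.le hβ1 hM0.ne'
    linarith
  have hdrift := potential_drift hβ0 hβ1 hX hM D
  unfold cutBound at h2 ⊢
  set q := 2 * β / (1 + β) with hq
  have hq0 : 0 < q := by positivity
  have hq1 : q < 1 := by
    rw [hq, div_lt_one (by linarith)]
    linarith
  set κ := q ^ (M + g) * (1 / 2) ^ m with hκ
  have hκ0 : 0 < κ := by positivity
  set δ := β ^ M with hδ
  set ε := 2 * g * (1 - β) with hε
  have hβ' : 0 < 1 - β := by linarith
  have hε0 : 0 ≤ ε := by positivity
  set t := D - g with ht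
  have hpt : ∀ J ∈ Finset.range M, (1 - β) * β ^ J / (1 - δ) * c J ≤
      (1 - β) * β ^ J / (1 - δ) * b
      + (if t ≤ J ∧ J < t + 2 * g then (1 - β) * β ^ J / (1 - δ) else 0)
      + (if J < t then (1 - β) * β ^ J / (1 - δ) *
        (ε * (1 + δ / (1 - δ) * (potential q (insertBelow X (D - J)) / κ))) else 0) := by
    intro J hJ
    have hJ : J < M := Finset.mem_range.1 hJ
    have hπ : 0 ≤ (1 - β) * β ^ J / (1 - δ) := by positivity
    by_cases hlt : J < t
    · rw [if_neg (by omega), if_pos hlt, add_zero, ← mul_add]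
      exact mul_le_mul_of_nonneg_left (h2 J hJ (by omega)) hπ
    · rw [if_neg hlt, add_zero]
      by_cases hw : t ≤ J ∧ J < t + 2 * g
      · rw [if_pos hw]
        have := mul_le_mul_of_nonneg_left (h3 J hJ) hπ
        nlinarith [mul_nonneg hπ hb]
      · rw [if_neg hw, add_zero]
        exact mul_le_mul_of_nonneg_left (h1 J hJ (by omega)) hπ
  refine (Finset.sum_le_sum hpt).trans ?_
  rw [Finset.sum_add_distrib, Finset.sum_add_distrib]
  have hgeom : ∀ n, ∑ J ∈ Finset.range n, (1 - β) * β ^ J = 1 - β ^ n := by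
    intro n
    rw [← Finset.mul_sum]
    linarith [mul_neg_geom_sum β n]
  have s1 : ∑ J ∈ Finset.range M, (1 - β) * β ^ J / (1 - δ) * b = b := by
    rw [← Finset.sum_mul, ← Finset.sum_div, hgeom, ← hδ, div_self hδ1.ne', one_mul]
  rw [s1, add_assoc]
  gcongr
  have hpot : ∀ Y, 0 ≤ potential q Y := potential_nonneg hq0.le hq1.le
  -- the part of the sum with small radii
  have s3 : ∑ J ∈ Finset.range M, (if J < t then (1 - β) * β ^ J / (1 - δ) *
        (ε * (1 + δ / (1 - δ) * (potential q (insertBelow X (D - J)) / κ))) else 0)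
      = ε * ((1 - β ^ min M t) / (1 - δ) + δ / (1 - δ) * ((∑ J ∈ Finset.range (min M t),
          (1 - β) * β ^ J * potential q (insertBelow X (D - J))) / (1 - δ) / κ)) := by
    rw [← Finset.sum_filter]
    have : (Finset.range M).filter (· < t) = Finset.range (min M t) := by
      ext; simp
    rw [this, ← hgeom (min M t), Finset.sum_div, Finset.sum_div, Finset.sum_div, Finset.mul_sum,
      ← Finset.sum_add_distrib, Finset.mul_sum]
    refine Finset.sum_congr rfl fun J _ => ?_
    ring
  have s4 : ∑ J ∈ Finset.range (min M t),
        (1 - β) * β ^ J * potential q (insertBelow X (D - J)) ≤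
      ∑ J ∈ Finset.range (min M D),
        (1 - β) * β ^ J * potential q (insertBelow X (D - J)) := by
    refine Finset.sum_le_sum_of_subset_of_nonneg (by
      intro x; simp only [Finset.mem_range]; omega) fun J _ _ => ?_
    have := hpot (insertBelow X (D - J))
    positivity
  rw [s3]
  rcases le_or_gt M t with hMt | hMt
  · have s2 : ∑ J ∈ Finset.range M, (if t ≤ J ∧ J < t + 2 * g then (1 - β) * β ^ J / (1 - δ)
        else 0) = 0 := by
      refine Finset.sum_eq_zero fun J hJ => if_neg ?_
      have := Finset.mem_range.1 hJ
      omega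
    rw [s2, zero_add, min_eq_left hMt, ← hδ, div_self hδ1.ne']
    rw [min_eq_left hMt] at s4
    gcongr
    rw [div_le_iff₀ hδ1]
    have : 0 ≤ q ^ D * (1 / 2) ^ m := by positivity
    linarith
  · have s2 : ∑ J ∈ Finset.range M, (if t ≤ J ∧ J < t + 2 * g then (1 - β) * β ^ J / (1 - δ)
        else 0) ≤ ε * (β ^ t / (1 - δ)) := by
      rw [← Finset.sum_filter]
      calc _ ≤ ∑ J ∈ Finset.Ico t (t + 2 * g), (1 - β) * β ^ J / (1 - δ) := by
            refine Finset.sum_le_sum_of_subset_of_nonneg ?_ fun J _ _ => by positivity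
            intro x
            simp
        _ ≤ ∑ J ∈ Finset.Ico t (t + 2 * g), (1 - β) * β ^ t / (1 - δ) := by
            refine Finset.sum_le_sum fun J hJ => ?_
            have := (Finset.mem_Ico.1 hJ).1
            have := pow_le_pow_of_le_one hβ0.le hβ1.le this
            gcongr
        _ = _ := by
            rw [Finset.sum_const, Nat.card_Ico, hε]
            simp
            ring
    have hD : D ≤ M + g := by omega
    have hκD : κ ≤ q ^ D * (1 / 2) ^ m := by
      rw [hκ]
      exact mul_le_mul_of_nonneg_right (pow_le_pow_of_le_one hq0.le hq1.le hD) (by positivity)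
    rw [min_eq_right hMt.le] at s4 ⊢
    have s5 : (∑ J ∈ Finset.range t, (1 - β) * β ^ J * potential q (insertBelow X (D - J)))
        / (1 - δ) / κ + 1 ≤ potential q X / κ := by
      have hk : κ / (1 - δ) ≥ κ := by
        rw [ge_iff_le, le_div_iff₀ hδ1]
        nlinarith
      rw [div_add_one hκ0.ne']
      gcongr
      have : (∑ J ∈ Finset.range t, (1 - β) * β ^ J * potential q (insertBelow X (D - J)) + κ)
          / (1 - δ) ≤ potential q X := by
        rw [div_le_iff₀ hδ1]
        linarith
      rw [add_div] at this
      linarith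
    have s6 : (1 : ℝ) / (1 - δ) = 1 + δ / (1 - δ) := by
      field_simp
      ring
    have s7 : 0 ≤ δ / (1 - δ) := by positivity
    calc _ ≤ ε * (β ^ t / (1 - δ)) + ε * ((1 - β ^ t) / (1 - δ) + δ / (1 - δ) *
          (potential q X / κ - 1)) := by
          gcongr
          linarith
      _ = ε * (1 / (1 - δ) - δ / (1 - δ) + δ / (1 - δ) * (potential q X / κ)) := by ring
      _ = _ := by
          rw [s6]
          ring

end Potential

section Shifts

variable {G : SimpleGraph V} {w : V → V → ℝ} {S : Set V}

/-- Every vertex chooses the centre minimising the shifted distance; the vertices choosing a given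
centre form a star-shaped set. -/
lemma exists_shifted_assignment [Finite V] (hpos : ∀ u v, G.Adj u v → 0 < w u v)
    {N : Finset V} (hN : N.Nonempty) (δ : V → ℝ≥0∞) :
    ∃ F : V → V, (∀ v, F v ∈ N) ∧
      (∀ v, ∀ c ∈ N, dIn G w S v (F v) + δ (F v) ≤ dIn G w S v c + δ c) ∧
      ∀ v, dIn G w S v (F v) < ⊤ →
        dIn G w {u | u ∈ S ∧ F u = F v} v (F v) ≤ dIn G w S v (F v) := by
  obtain ⟨n, ⟨e⟩⟩ := Finite.exists_equiv_fin V
  let key : V → V → ℝ≥0∞ ×ₗ Fin n := fun v c => toLex (dIn G w S v c + δ c, e c)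
  choose F hFN hF using fun v => Finset.exists_min_image N (key v) hN
  refine ⟨F, hFN, fun v c hc => ?_, fun v hv => ?_⟩
  · rcases Prod.Lex.le_iff.1 (hF v c hc) with h | h
    exacts [h.le, h.1.le]
  generalize hc : F v = c at hv ⊢
  have hcN : c ∈ N := hc ▸ hFN v
  rw [← dSet_singleton] at hv
  revert hc
  refine dSet_induction (s := S) (A := {c}) (P := fun v => F v = c →
    dIn G w {u | u ∈ S ∧ F u = c} v c ≤ dIn G w S v c) hpos ?_ ?_ hv
  · rintro a rfl haS ha
    exact (dIn_self (s := {u | u ∈ S ∧ F u = a}) ⟨haS, ha⟩).le.trans bot_le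
  · intro x y hx hy hxc hxy hyt h ih hFx
    rw [dSet_singleton, dSet_singleton] at h
    rw [dSet_singleton] at hyt
    have hFy : F y = c := by
      have hle : key y c ≤ key y (F y) := by
        have h1 : dIn G w S x (F y) + δ (F y) ≤
            ENNReal.ofReal (w x y) + (dIn G w S y (F y) + δ (F y)) := by
          rw [← add_assoc]
          gcongr
          exact dIn_le_of_adj hpos hx hxy
        have hmin := hF x (F y) (hFN y)
        rw [hFx] at hmin
        rw [Prod.Lex.le_iff] at hmin ⊢
        simp only [key, ofLex_toLex, h] at hmin ⊢
        rcases hmin with h2 | ⟨h2, h3⟩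
        · left
          rw [add_assoc] at h2
          exact (ENNReal.add_lt_add_iff_left ENNReal.ofReal_ne_top).1 (h2.trans_le h1)
        · rw [add_assoc] at h2
          have h4 := (ENNReal.add_le_add_iff_left ENNReal.ofReal_ne_top).1 (h2.le.trans h1)
          rcases h4.lt_or_eq with h5 | h5
          exacts [Or.inl h5, Or.inr ⟨h5, h3⟩]
      have := le_antisymm hle (hF y c hcN)
      have : e c = e (F y) := congrArg (fun p => (ofLex p).2) this
      exact (e.injective this).symm
    refine (dIn_le_of_adj hpos (s := {u | u ∈ S ∧ F u = c}) ⟨hx, hFx⟩ hxy).trans ?_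
    rw [h]
    gcongr
    exact ih hFy

open Classical in
lemma card_mul_le_of_update {ι : Type*} [Fintype ι] {M q : ℕ} (E : Finset (ι → Fin M)) (i : ι)
    (h : ∀ k : ι → Fin M, (Finset.univ.filter fun a => Function.update k i a ∈ E).card ≤ q) :
    E.card * M ≤ q * Fintype.card (ι → Fin M) := by
  have h1 : (Finset.univ.filter fun p : (ι → Fin M) × Fin M =>
      Function.update p.1 i p.2 ∈ E).card = (E ×ˢ (Finset.univ : Finset (Fin M))).card := by
    refine Finset.card_bij' (fun p _ => (Function.update p.1 i p.2, p.1 i))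
      (fun p _ => (Function.update p.1 i p.2, p.1 i)) ?_ ?_ ?_ ?_
    · intro p hp
      simpa using hp
    · intro p hp
      simpa using hp
    · intro p hp
      simp
    · intro p hp
      simp
  rw [Finset.card_product, Finset.card_univ, Fintype.card_fin] at h1
  rw [← h1, Finset.card_eq_sum_card_fiberwise (f := Prod.fst) (t := Finset.univ) (by simp)]
  refine (Finset.sum_le_card_nsmul _ _ q fun k _ => ?_).trans (by simp [mul_comm])
  refine le_trans (Finset.card_le_card_of_injOn Prod.snd ?_ ?_) (h k)
  · rintro ⟨k', a⟩ hp
    simp only [Finset.coe_filter, Finset.mem_filter, Finset.mem_univ, true_and,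
      Set.mem_ofPred_eq] at hp ⊢
    exact hp.2 ▸ hp.1
  · rintro ⟨k1, a1⟩ h1 ⟨k2, a2⟩ h2 hab
    simp only [Finset.coe_filter, Set.mem_ofPred_eq] at h1 h2
    exact Prod.ext (h1.2.trans h2.2.symm) hab

lemma card_le_of_diff_le {M d : ℕ} (s : Finset (Fin M))
    (h : ∀ a ∈ s, ∀ b ∈ s, (a : ℕ) ≤ b + d) : s.card ≤ d + 1 := by
  rcases s.eq_empty_or_nonempty with rfl | hs
  · simp
  obtain ⟨m, hm, hmin⟩ := s.exists_min_image id hs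
  have : s.card ≤ (Finset.Icc (m : ℕ) (m + d)).card := by
    refine Finset.card_le_card_of_injOn (fun a => (a : ℕ)) ?_ ?_
    · intro a ha
      have h1 : m ≤ a := hmin a ha
      have h2 := h a ha m hm
      simp only [Finset.coe_Icc, Set.mem_Icc]
      exact ⟨h1, h2⟩
    · intro a _ b _ hab
      exact Fin.ext hab
  rw [Nat.card_Icc] at this
  omega

open Classical in
/-- Exponential-shift style clustering of a set `S` around centres `N`, with uniform shifts. -/
lemma exists_shifted_partition [Fintype V] (hpos : ∀ u v, G.Adj u v → 0 < w u v)
    (hsymm : ∀ u v, w u v = w v u) {h : ℝ≥0∞} (h0 : h ≠ 0) (ht : h ≠ ⊤) {M A : ℕ} (hM : 0 < M)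
    (N : Finset V) (hcov : ∀ v ∈ S, ∃ c ∈ N, dIn G w S v c ≤ 2 * M * h)
    (hcount : ∀ z ∈ S, (N.filter fun c => dIn G w S z c ≤ 5 * M * h).card ≤ A) :
    ∃ μ : PMF (V → ℕ),
      (∀ f ∈ μ.support, ∀ x ∈ S, ∀ y ∈ S, f x = f y →
        dIn G w {v | v ∈ S ∧ f v = f x} x y ≤ 6 * M * h) ∧
      ∀ z ∈ S, ∀ g ≤ M, ∀ B : Set V, (∀ v ∈ B, dIn G w S z v ≤ g * h) →
        μ.toOuterMeasure {f | ∃ y ∈ B, f y ≠ f z} ≤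
          ENNReal.ofReal ((A : ℝ) ^ 2 * (2 * g + 1) / M) := by
  rcases S.eq_empty_or_nonempty with rfl | ⟨v₀, hv₀⟩
  · exact ⟨PMF.pure 0, by simp, by simp⟩
  have hN : N.Nonempty := by
    obtain ⟨c, hc, -⟩ := hcov v₀ hv₀
    exact ⟨c, hc⟩
  have : Nonempty (Fin M) := ⟨⟨0, hM⟩⟩
  obtain ⟨n, ⟨e⟩⟩ := Finite.exists_equiv_fin V
  choose F hFN hF hstar using fun k : V → Fin M =>
    exists_shifted_assignment (S := S) hpos hN (fun c => (k c : ℕ) * h)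
  have hinj : ∀ a b : V, ((e a : Fin n) : ℕ) = e b → a = b := fun a b hab =>
    e.injective (Fin.ext hab)
  have hfin : ∀ a : ℕ, (a : ℝ≥0∞) * h < ⊤ := fun a =>
    lt_top_iff_ne_top.2 (ENNReal.mul_ne_top (by simp) ht)
  have hclose' : ∀ k, ∀ v ∈ S,
      dIn G w S v (F k v) + (k (F k v) : ℕ) * h ≤ (3 * M : ℕ) * h := by
    intro k v hv
    obtain ⟨c, hc, hvc⟩ := hcov v hv
    calc _ ≤ _ := hF k v c hc
      _ ≤ 2 * M * h + M * h := by
          gcongr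
          exact (k c).2.le
      _ = _ := by
          push_cast
          ring
  have hclose : ∀ k, ∀ v ∈ S, dIn G w S v (F k v) ≤ (3 * M : ℕ) * h := fun k v hv =>
    le_self_add.trans (hclose' k v hv)
  refine ⟨(PMF.uniformOfFintype (V → Fin M)).map fun k v => e (F k v), ?_, ?_⟩
  · intro f hf x hx y hy hxy
    rw [PMF.support_map] at hf
    obtain ⟨k, -, rfl⟩ := hf
    have hF' : F k x = F k y := hinj _ _ hxy
    have hset : {v | v ∈ S ∧ ((e (F k v) : Fin n) : ℕ) = e (F k x)} =
        {v | v ∈ S ∧ F k v = F k x} := by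
      ext v
      exact and_congr_right fun _ => ⟨fun h => hinj _ _ h, fun h => by rw [h]⟩
    simp only [hset]
    have h1 := hstar k x ((hclose k x hx).trans_lt (hfin _))
    have h2 := hstar k y ((hclose k y hy).trans_lt (hfin _))
    rw [← hF'] at h2
    have hyc := hclose k y hy
    rw [← hF'] at hyc
    calc _ ≤ _ := dIn_triangle hpos (y := F k x)
      _ ≤ (3 * M : ℕ) * h + (3 * M : ℕ) * h := by
          gcongr
          · exact h1.trans (hclose k x hx)
          · rw [dIn_comm hsymm]
            exact h2.trans hyc
      _ = _ := by
          push_cast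
          ring
  · intro z hz g hg B hB
    set R := N.filter fun c => dIn G w S z c ≤ 5 * M * h with hR
    let E : V × V → Finset (V → Fin M) := fun c => Finset.univ.filter fun k =>
      dIn G w S z c.1 + (k c.1 : ℕ) * h ≤ dIn G w S z c.2 + (k c.2 : ℕ) * h ∧
      dIn G w S z c.2 + (k c.2 : ℕ) * h ≤
        dIn G w S z c.1 + (k c.1 : ℕ) * h + (2 * g : ℕ) * h
    have hE : ∀ c ∈ R.offDiag, (E c).card * M ≤ (2 * g + 1) * Fintype.card (V → Fin M) := by
      rintro ⟨c, c'⟩ hc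
      obtain ⟨hcR, hcR', hne⟩ := Finset.mem_offDiag.1 hc
      have hfc' : dIn G w S z c' ≠ ⊤ := by
        refine ((Finset.mem_filter.1 hcR').2.trans_lt ?_).ne
        have := hfin (5 * M)
        push_cast at this
        exact this
      refine card_mul_le_of_update _ c' fun k => card_le_of_diff_le _ ?_
      intro a ha b hb
      simp only [E, Finset.mem_filter, Finset.mem_univ, true_and, Function.update_self,
        Function.update_of_ne hne] at ha hb
      have h1 := ha.2.trans (add_le_add_left hb.1 _)
      rw [add_assoc] at h1
      have h2 := (ENNReal.add_le_add_iff_left hfc').1 h1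
      rw [← add_mul, ENNReal.mul_le_mul_iff_left h0 ht] at h2
      exact_mod_cast h2
    have hsub : (Finset.univ.filter fun k : V → Fin M => ∃ y ∈ B, F k y ≠ F k z) ⊆
        R.offDiag.biUnion E := by
      intro k hk
      obtain ⟨y, hyB, hne⟩ := (Finset.mem_filter.1 hk).2
      have hzy : dIn G w S z y ≤ g * h := hB y hyB
      have hchain : dIn G w S z (F k y) + (k (F k y) : ℕ) * h ≤
          dIn G w S z (F k z) + (k (F k z) : ℕ) * h + (2 * g : ℕ) * h := by
        calc _ ≤ g * h + dIn G w S y (F k y) + (k (F k y) : ℕ) * h := by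
              gcongr
              exact (dIn_triangle hpos (y := y)).trans (by gcongr)
          _ ≤ g * h + (dIn G w S y (F k z) + (k (F k z) : ℕ) * h) := by
              rw [add_assoc]
              exact add_le_add le_rfl (hF k y _ (hFN k z))
          _ ≤ g * h + (g * h + dIn G w S z (F k z) + (k (F k z) : ℕ) * h) := by
              gcongr
              refine (dIn_triangle hpos (y := z)).trans ?_
              gcongr
              rw [dIn_comm hsymm]
              exact hzy
          _ = _ := by
              push_cast
              ring
      have hz1 := hclose' k z hz
      have hg' : (g : ℝ≥0∞) ≤ M := by exact_mod_cast hg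
      refine Finset.mem_biUnion.2 ⟨(F k z, F k y), Finset.mem_offDiag.2 ⟨?_, ?_, hne.symm⟩, ?_⟩
      · refine Finset.mem_filter.2 ⟨hFN k z, (hclose k z hz).trans ?_⟩
        push_cast
        gcongr
        norm_num
      · refine Finset.mem_filter.2 ⟨hFN k y, (le_self_add.trans hchain).trans ?_⟩
        calc _ ≤ (3 * M : ℕ) * h + (2 * M : ℕ) * h := by
              gcongr
          _ = _ := by
              push_cast
              ring
      · exact Finset.mem_filter.2 ⟨Finset.mem_univ _, hF k z _ (hFN k y), hchain⟩
    have hcard : (Finset.univ.filter fun k : V → Fin M => ∃ y ∈ B, F k y ≠ F k z).card * M ≤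
        A ^ 2 * (2 * g + 1) * Fintype.card (V → Fin M) := by
      calc _ ≤ (∑ c ∈ R.offDiag, (E c).card) * M := by
            gcongr
            exact (Finset.card_le_card hsub).trans Finset.card_biUnion_le
        _ = ∑ c ∈ R.offDiag, (E c).card * M := Finset.sum_mul _ _ _
        _ ≤ R.offDiag.card * ((2 * g + 1) * Fintype.card (V → Fin M)) := by
            simpa using Finset.sum_le_card_nsmul _ _ _ hE
        _ ≤ A ^ 2 * ((2 * g + 1) * Fintype.card (V → Fin M)) := by
            gcongr
            have := hcount z hz
            rw [Finset.offDiag_card, pow_two]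
            exact (Nat.sub_le _ _).trans (Nat.mul_le_mul this this)
        _ = _ := by ring
    rw [PMF.toOuterMeasure_map_apply, PMF.toOuterMeasure_uniformOfFintype_apply]
    have hset : ((fun k v => ((e (F k v) : Fin n) : ℕ)) ⁻¹' {f : V → ℕ | ∃ y ∈ B, f y ≠ f z})
        = ((Finset.univ.filter fun k : V → Fin M => ∃ y ∈ B, F k y ≠ F k z) :
          Set (V → Fin M)) := by
      ext k
      simp only [Set.mem_preimage, Set.mem_ofPred_eq, Finset.coe_filter, Finset.mem_univ, true_and]
      refine exists_congr fun y => and_congr_right fun _ => not_congr ⟨fun h => hinj _ _ h, ?_⟩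
      intro h
      rw [h]
    simp only [hset, Fintype.card_coe, Finset.coe_sort_coe]
    have hM' : (0 : ℝ) < M := by exact_mod_cast hM
    have hcV : 0 < Fintype.card (V → Fin M) := Fintype.card_pos
    have hcV' : (0 : ℝ) < Fintype.card (V → Fin M) := by exact_mod_cast hcV
    rw [← ENNReal.ofReal_natCast, ← ENNReal.ofReal_natCast (Fintype.card (V → Fin M)),
      ← ENNReal.ofReal_div_of_pos hcV']
    refine ENNReal.ofReal_le_ofReal ?_
    rw [div_le_div_iff₀ hcV' hM']
    exact_mod_cast hcard

end Shifts

section Centers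

variable {G : SimpleGraph V} {w : V → V → ℝ} {S : Set V}

open Classical in
/-- If a set `S` is covered by the neighbourhoods of few geodesics, then it has a net of centres
such that every ball contains few of them. -/
lemma exists_centers [Fintype V] (hpos : ∀ u v, G.Adj u v → 0 < w u v)
    (hsymm : ∀ u v, w u v = w v u) {l : ℝ≥0∞} (h0 : l ≠ 0) (ht : l ≠ ⊤)
    (f : V → ℝ≥0∞) (𝒬 : Finset (Set V))
    (hlip : ∀ u v, f u ≤ dIn G w S u v + f v)
    (hQS : ∀ Q ∈ 𝒬, Q ⊆ S) (hfin : ∀ Q ∈ 𝒬, ∀ u ∈ Q, f u < ⊤)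
    (hgeo : ∀ Q ∈ 𝒬, ∀ u ∈ Q, ∀ v ∈ Q, f u ≤ f v → dIn G w Q u v + f u ≤ f v)
    (hcov : ∀ v ∈ S, ∃ Q ∈ 𝒬, ∃ q ∈ Q, dIn G w S v q ≤ l) :
    ∃ N : Finset V, (∀ v ∈ S, ∃ c ∈ N, dIn G w S v c ≤ 2 * l) ∧
      ∀ z, (N.filter fun c => dIn G w S z c ≤ 5 * l).card ≤ 11 * 𝒬.card := by
  rcases isEmpty_or_nonempty V with _ | _
  · exact ⟨∅, fun v => isEmptyElim v, fun v => isEmptyElim v⟩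
  have hex : ∀ q, f q < ⊤ → ∃ n : ℕ, f q ≤ n * l := fun q hq => by
    obtain ⟨n, hn⟩ := ENNReal.exists_nat_mul_gt h0 hq.ne
    exact ⟨n, hn.le⟩
  let b : V → ℕ := fun q => if h : f q < ⊤ then Nat.find (hex q h) else 0
  have hb1 : ∀ q, f q < ⊤ → f q ≤ b q * l := fun q hq => by
    simp only [b, dif_pos hq]
    exact Nat.find_spec (hex q hq)
  have hb2 : ∀ q, f q < ⊤ → b q * l ≤ f q + l := fun q hq => by
    rcases Nat.eq_zero_or_pos (b q) with h | h
    · simp [h]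
    · obtain ⟨n, hn⟩ : ∃ n, b q = n + 1 := ⟨b q - 1, by omega⟩
      have hlt : n < Nat.find (hex q hq) := by
        have : b q = Nat.find (hex q hq) := by simp only [b, dif_pos hq]
        omega
      have := not_le.1 (Nat.find_min (hex q hq) hlt)
      rw [hn]
      push_cast
      rw [add_mul, one_mul]
      gcongr
  have hb3 : ∀ q n, f q ≤ (n : ℕ) * l → b q ≤ n := fun q n hq => by
    have hq' : f q < ⊤ := hq.trans_lt (ENNReal.mul_lt_top (by simp) ht.lt_top)
    simp only [b, dif_pos hq']
    exact Nat.find_min' _ hq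
  have hchoice : ∀ Q : Set V, ∀ n : ℕ, ∃ c : V, (∃ q ∈ Q, b q = n) → c ∈ Q ∧ b c = n := by
    intro Q n
    by_cases h : ∃ q ∈ Q, b q = n
    · obtain ⟨q, hq⟩ := h
      exact ⟨q, fun _ => hq⟩
    · exact ⟨Classical.arbitrary V, fun h' => absurd h' h⟩
  choose ctr hctr using hchoice
  refine ⟨Finset.univ.filter fun c => ∃ Q ∈ 𝒬, c ∈ Q ∧ c = ctr Q (b c), fun v hv => ?_,
    fun z => ?_⟩
  · obtain ⟨Q, hQ, q, hq, hvq⟩ := hcov v hv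
    obtain ⟨h1, h2⟩ := hctr Q (b q) ⟨q, hq, rfl⟩
    refine ⟨ctr Q (b q), ?_, ?_⟩
    · simp only [Finset.mem_filter, Finset.mem_univ, true_and]
      exact ⟨Q, hQ, h1, by rw [h2]⟩
    · set c := ctr Q (b q)
      have key : ∀ u ∈ Q, ∀ u' ∈ Q, b u = b u' → f u ≤ f u' → dIn G w S u u' ≤ l := by
        intro u hu u' hu' hbb huu
        have h3 := (add_le_add (dIn_mono (hQS Q hQ)) le_rfl).trans (hgeo Q hQ u hu u' hu' huu)
        have h4 : dIn G w S u u' + f u ≤ l + f u := by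
          calc _ ≤ f u' := h3
            _ ≤ b u' * l := hb1 u' (hfin Q hQ u' hu')
            _ = b u * l := by rw [hbb]
            _ ≤ _ := (hb2 u (hfin Q hQ u hu)).trans (add_comm _ _).le
        exact (ENNReal.add_le_add_iff_right (hfin Q hQ u hu).ne).1 h4
      have hqc : dIn G w S q c ≤ l := by
        rcases le_total (f q) (f c) with h | h
        · exact key q hq c h1 h2.symm h
        · rw [dIn_comm hsymm]
          exact key c h1 q hq h2 h
      calc _ ≤ _ := dIn_triangle hpos (y := q)
        _ ≤ l + l := add_le_add hvq hqc
        _ = _ := (two_mul _).symm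
  · rcases (Finset.univ.filter fun c => dIn G w S z c ≤ 5 * l ∧
      ∃ Q ∈ 𝒬, c ∈ Q ∧ c = ctr Q (b c)).eq_empty_or_nonempty with he | hne
    · rw [Finset.filter_filter, Finset.filter_congr fun c _ => and_comm, he]
      simp
    obtain ⟨c₀, hc₀, hmin⟩ := Finset.exists_min_image _ b hne
    refine (Finset.card_le_card (t := 𝒬.biUnion fun Q =>
      (Finset.Icc (b c₀) (b c₀ + 10)).image (ctr Q)) fun c hc => ?_).trans
      ((Finset.card_biUnion_le_card_mul _ _ 11 fun Q _ =>
        Finset.card_image_le.trans (by rw [Nat.card_Icc]; omega)).trans_eq (mul_comm _ _))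
    simp only [Finset.mem_filter, Finset.mem_univ, true_and] at hc hc₀ hmin
    obtain ⟨⟨Q, hQ, hcQ, hceq⟩, hzc⟩ := hc
    obtain ⟨hzc₀, Q₀, hQ₀, hcQ₀, -⟩ := hc₀
    refine Finset.mem_biUnion.2 ⟨Q, hQ, Finset.mem_image.2 ⟨b c, ?_, hceq.symm⟩⟩
    refine Finset.mem_Icc.2 ⟨hmin c ⟨hzc, Q, hQ, hcQ, hceq⟩, hb3 c _ ?_⟩
    calc f c ≤ dIn G w S c c₀ + f c₀ := hlip _ _
      _ ≤ (5 * l + 5 * l) + b c₀ * l := by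
        refine add_le_add ((dIn_triangle hpos (y := z)).trans (add_le_add ?_ hzc₀))
          (hb1 _ (hfin Q₀ hQ₀ _ hcQ₀))
        rw [dIn_comm hsymm]
        exact hzc
      _ = _ := by
        push_cast
        ring

end Centers

section Clique

variable {G : SimpleGraph V} {w : V → V → ℝ} {U A S : Set V} {𝒮 : Set (Set V)} {t z : V}

/-- The component of `z` in `U` is adjacent to the set `S`. -/
def Touches (G : SimpleGraph V) (w : V → V → ℝ) (U : Set V) (z : V) (S : Set V) : Prop :=
  ∃ u, dIn G w U z u < ⊤ ∧ ∃ a ∈ S, G.Adj u a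

/-- The sets in `𝒮` are the branch sets of a minor living outside of `U`; those adjacent to a
common component of `U` form a clique. -/
structure IsCliqueState (G : SimpleGraph V) (w : V → V → ℝ) (U : Set V) (𝒮 : Set (Set V)) :
    Prop where
  connected : ∀ S ∈ 𝒮, (G.induce S).Connected
  disjoint : ∀ S ∈ 𝒮, Disjoint S U
  pairwise : ∀ S ∈ 𝒮, ∀ S' ∈ 𝒮, S ≠ S' → Disjoint S S'
  adj : ∀ S ∈ 𝒮, ∀ S' ∈ 𝒮, S ≠ S' → ∀ z, Touches G w U z S → Touches G w U z S' →
    ∃ a ∈ S, ∃ b ∈ S', G.Adj a b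

lemma IsCliqueState.card_lt [Finite V] (h : IsCliqueState G w U 𝒮)
    (hpos : ∀ u v, G.Adj u v → 0 < w u v) (hsymm : ∀ u v, w u v = w v u) {r : ℕ}
    (hG : ¬ HasCliqueMinor G (r + 1)) (hz : z ∈ U) {𝒳 : Finset (Set V)} (h𝒳 : ↑𝒳 ⊆ 𝒮)
    (ht : ∀ S ∈ 𝒳, Touches G w U z S) : 𝒳.card < r := by
  by_contra! hr
  obtain ⟨𝒴, h𝒴, hcard⟩ := Finset.exists_subset_card_eq hr
  let e : Fin r ≃ 𝒴 := (Finset.equivFinOfCardEq hcard).symm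
  have he : ∀ i, (e i : Set V) ∈ 𝒮 := fun i => h𝒳 (h𝒴 (e i).2)
  have het : ∀ i, Touches G w U z (e i) := fun i => ht _ (h𝒴 (e i).2)
  have hne : ∀ i j, i ≠ j → (e i : Set V) ≠ e j := fun i j hij h =>
    hij (e.injective (Subtype.ext h))
  set K : Set V := {u | dIn G w U z u < ⊤} with hK
  have hzK : z ∈ K := by
    rw [hK, Set.mem_ofPred_eq, dIn_self hz]
    exact ENNReal.zero_lt_top
  have hKU : K ⊆ U := fun u hu => mem_right_of_dIn_lt_top hu
  have hKc : (G.induce K).Connected := by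
    refine induce_connected_of_dIn_lt_top (w := w) (fun v hv => ?_) hzK
    rw [dIn_comm hsymm]
    exact (dIn_le_of_local hpos hsymm hv fun u hu => hu.trans_lt hv).trans_lt hv
  have hdisj : ∀ i, Disjoint K (e i) := fun i =>
    ((h.disjoint _ (he i)).mono_right hKU).symm
  have hadj : ∀ i, ∃ u ∈ K, ∃ v ∈ (e i : Set V), G.Adj u v := fun i => het i
  refine hG ⟨Fin.cons K fun i => e i, ?_, ?_, ?_, ?_⟩
  · refine Fin.cases ⟨z, hzK⟩ fun i => ?_
    exact Set.nonempty_coe_sort.1 (h.connected _ (he i)).nonempty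
  · exact Fin.cases hKc fun i => h.connected _ (he i)
  · refine Fin.cases (Fin.cases (fun h => absurd rfl h) fun j _ => hdisj j) fun i =>
      Fin.cases (fun _ => (hdisj i).symm) fun j hij => ?_
    exact h.pairwise _ (he i) _ (he j) (hne i j fun h => hij (congrArg _ h))
  · refine Fin.cases (Fin.cases (fun h => absurd rfl h) fun j _ => hadj j) fun i =>
      Fin.cases (fun _ => ?_) fun j hij => ?_
    · obtain ⟨u, hu, v, hv, huv⟩ := hadj i
      exact ⟨v, hv, u, hu, huv.symm⟩
    · exact h.adj _ (he i) _ (he j) (hne i j fun h => hij (congrArg _ h)) z (het i) (het j)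

lemma IsCliqueState.carve [Finite V] (h : IsCliqueState G w U 𝒮)
    (hpos : ∀ u v, G.Adj u v → 0 < w u v) (hsymm : ∀ u v, w u v = w v u)
    (ht : t ∈ A) (hAU : A ⊆ U) (hA : ∀ v ∈ A, dIn G w A v t < ⊤)
    (hadj : ∀ S ∈ 𝒮, Touches G w U t S → ∃ a ∈ A, ∃ b ∈ S, G.Adj a b) :
    IsCliqueState G w (U \ A) (insert A 𝒮) := by
  have hmono : ∀ {z S}, Touches G w (U \ A) z S → Touches G w U z S := by
    rintro z S ⟨u, hu, hu'⟩
    exact ⟨u, (dIn_mono Set.sdiff_subset).trans_lt hu, hu'⟩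
  have key : ∀ S ∈ 𝒮, ∀ z, Touches G w (U \ A) z A → Touches G w (U \ A) z S →
      ∃ a ∈ A, ∃ b ∈ S, G.Adj a b := by
    rintro S hS z ⟨u, hu, a, ha, hua⟩ hzS
    obtain ⟨u', hu', hu'S⟩ := hmono hzS
    refine hadj S hS ⟨u', ?_, hu'S⟩
    have h1 : dIn G w U t a < ⊤ := by
      rw [dIn_comm hsymm]
      exact (dIn_mono hAU).trans_lt (hA a ha)
    have h2 : dIn G w U a z < ⊤ := by
      refine (dIn_le_of_adj hpos (hAU ha) hua.symm).trans_lt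
        (ENNReal.add_lt_top.2 ⟨ENNReal.ofReal_lt_top, ?_⟩)
      rw [dIn_comm hsymm]
      exact (dIn_mono Set.sdiff_subset).trans_lt hu
    exact (dIn_triangle hpos (y := a)).trans_lt (ENNReal.add_lt_top.2
      ⟨h1, (dIn_triangle hpos (y := z)).trans_lt (ENNReal.add_lt_top.2 ⟨h2, hu'⟩)⟩)
  refine ⟨?_, ?_, ?_, ?_⟩
  · rintro S (rfl | hS)
    exacts [induce_connected_of_dIn_lt_top hA ht, h.connected S hS]
  · rintro S (rfl | hS)
    exacts [Set.disjoint_sdiff_right, (h.disjoint S hS).mono_right Set.sdiff_subset]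
  · rintro S (rfl | hS) S' (rfl | hS') hne
    exacts [absurd rfl hne, ((h.disjoint S' hS').mono_right hAU).symm,
      (h.disjoint S hS).mono_right hAU, h.pairwise S hS S' hS' hne]
  · rintro S (rfl | hS) S' (rfl | hS') hne z hz hz'
    · exact absurd rfl hne
    · exact key S' hS' z hz hz'
    · obtain ⟨a, ha, b, hb, hab⟩ := key S hS z hz' hz
      exact ⟨b, hb, a, ha, hab.symm⟩
    · exact h.adj S hS S' hS' hne z (hmono hz) (hmono hz')

end Clique

section Carving

variable {G : SimpleGraph V} {w : V → V → ℝ} {U : Set V} {𝒮 : Set (Set V)} {t : V}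

/-- The union `T` of geodesics from `t` to the branch sets adjacent to its component: each of its
neighbourhoods is a new branch set, and has a good clustering. -/
lemma IsCliqueState.exists_carving [Fintype V] (hU : IsCliqueState G w U 𝒮)
    (hpos : ∀ u v, G.Adj u v → 0 < w u v) (hsymm : ∀ u v, w u v = w v u) {r : ℕ}
    (hG : ¬ HasCliqueMinor G (r + 1)) (ht : t ∈ U) {h : ℝ≥0∞} (h0 : h ≠ 0) (htop : h ≠ ⊤)
    {M : ℕ} (hM : 0 < M) :
    ∃ T : Set V, t ∈ T ∧ T ⊆ U ∧ ∀ J ≤ M, ∀ S : Set V, S = {v | v ∈ U ∧ dSet G w U v T ≤ J * h} →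
      IsCliqueState G w (U \ S) (insert S 𝒮) ∧
      ∃ μ : PMF (V → ℕ),
        (∀ f ∈ μ.support, ∀ x ∈ S, ∀ y ∈ S, f x = f y →
          dIn G w {v | v ∈ S ∧ f v = f x} x y ≤ 6 * M * h) ∧
        ∀ z ∈ S, ∀ g ≤ M, ∀ B : Set V, (∀ v ∈ B, dIn G w S z v ≤ g * h) →
          μ.toOuterMeasure {f | ∃ y ∈ B, f y ≠ f z} ≤
            ENNReal.ofReal (((11 * r : ℕ) : ℝ) ^ 2 * (2 * g + 1) / M) := by
  classical
  have : Nonempty V := ⟨t⟩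
  choose! u hut hadj using fun (S : Set V) (hS : Touches G w U t S) => hS
  choose! Q hQU htQ huQ hQt hQ using fun (S : Set V) (hS : Touches G w U t S) =>
    exists_geodesic hpos hsymm ((dIn_comm hsymm (x := u S) (y := t)).trans_lt (hut S hS))
  let 𝒯 : Finset (Set V) := Finset.univ.filter fun S => S ∈ 𝒮 ∧ Touches G w U t S
  have h𝒯 : 𝒯.card < r := hU.card_lt hpos hsymm hG ht
    (fun S hS => (Finset.mem_filter.1 hS).2.1) fun S hS => (Finset.mem_filter.1 hS).2.2
  let 𝒬 : Finset (Set V) := insert {t} (𝒯.image Q)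
  have h𝒬 : 𝒬.card ≤ r :=
    (Finset.card_insert_le _ _).trans ((Nat.succ_le_succ Finset.card_image_le).trans h𝒯)
  have hforall : ∀ P : Set V → Prop, P {t} → (∀ S ∈ 𝒮, Touches G w U t S → P (Q S)) →
      ∀ q ∈ 𝒬, P q := by
    intro P h1 h2 q hq
    rcases Finset.mem_insert.1 hq with rfl | hq
    · exact h1
    · obtain ⟨S, hS, rfl⟩ := Finset.mem_image.1 hq
      exact h2 S (Finset.mem_filter.1 hS).2.1 (Finset.mem_filter.1 hS).2.2
  have h𝒬U : ∀ q ∈ 𝒬, q ⊆ U :=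
    hforall _ (Set.singleton_subset_iff.2 ht) fun S _ hS => hQU S hS
  have ht𝒬 : ∀ q ∈ 𝒬, t ∈ q := hforall _ rfl fun S _ hS => htQ S hS
  have hfin : ∀ q ∈ 𝒬, ∀ v ∈ q, dIn G w U v t < ⊤ := by
    refine hforall _ ?_ fun S _ hS => hQt S hS
    rintro v rfl
    rw [dIn_self ht]
    exact ENNReal.zero_lt_top
  have hgeo : ∀ q ∈ 𝒬, ∀ u ∈ q, ∀ v ∈ q, dIn G w U u t ≤ dIn G w U v t →
      dIn G w q u v + dIn G w U u t ≤ dIn G w U v t := by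
    refine hforall _ ?_ fun S _ hS => hQ S hS
    rintro v rfl v' rfl -
    rw [dIn_self (Set.mem_singleton _), zero_add]
  let T : Set V := {v | ∃ q ∈ 𝒬, v ∈ q}
  have hTU : T ⊆ U := fun v ⟨q, hq, hv⟩ => h𝒬U q hq hv
  refine ⟨T, ⟨{t}, Finset.mem_insert_self _ _, rfl⟩, hTU, fun J hJ S hS => ?_⟩
  have hTS : T ⊆ S := fun v hv => by
    rw [hS, Set.mem_ofPred_eq, dSet_self (hTU hv) hv]
    exact ⟨hTU hv, bot_le⟩
  have hSU : S ⊆ U := fun v hv => by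
    rw [hS] at hv
    exact hv.1
  have h𝒬S : ∀ q ∈ 𝒬, q ⊆ S := fun q hq v hv => hTS ⟨q, hq, hv⟩
  have hJt : (J : ℝ≥0∞) * h < ⊤ := ENNReal.mul_lt_top (by simp) htop.lt_top
  have hcov : ∀ v ∈ S, ∃ q ∈ 𝒬, ∃ c ∈ q, dIn G w S v c ≤ J * h := by
    intro v hv
    rw [hS] at hv
    obtain ⟨a, ⟨q, hq, haq⟩, ha⟩ := exists_dIn_le_of_dSet_le hpos hJt hv.2
    rw [← hS] at ha
    exact ⟨q, hq, a, haq, ha.trans hv.2⟩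
  have hSt : ∀ v ∈ S, dIn G w S v t < ⊤ := by
    intro v hv
    obtain ⟨q, hq, c, hc, hvc⟩ := hcov v hv
    refine (dIn_triangle hpos (y := c)).trans_lt (ENNReal.add_lt_top.2 ⟨hvc.trans_lt hJt, ?_⟩)
    rw [dIn_comm hsymm]
    refine (dIn_mono (h𝒬S q hq)).trans_lt (lt_of_le_of_lt ?_ (hfin q hq c hc))
    exact le_self_add.trans (hgeo q hq t (ht𝒬 q hq) c hc (by rw [dIn_self ht]; exact bot_le))
  refine ⟨hU.carve hpos hsymm (h𝒬S {t} (Finset.mem_insert_self _ _) rfl) hSU hSt ?_, ?_⟩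
  · intro S' hS' hS't
    exact ⟨u S', h𝒬S (Q S') (Finset.mem_insert_of_mem (Finset.mem_image_of_mem _
      (Finset.mem_filter.2 ⟨Finset.mem_univ _, hS', hS't⟩))) (huQ S' hS't), hadj S' hS't⟩
  · obtain ⟨N, hN, hN'⟩ := exists_centers (S := S) hpos hsymm (l := M * h)
      (mul_ne_zero (by simpa using hM.ne') h0) (ENNReal.mul_ne_top (by simp) htop)
      (fun v => dIn G w U v t) 𝒬
      (fun u v => (dIn_triangle hpos (y := v)).trans (add_le_add (dIn_mono hSU) le_rfl))
      h𝒬S hfin hgeo fun v hv => by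
        obtain ⟨q, hq, c, hc, hvc⟩ := hcov v hv
        exact ⟨q, hq, c, hc, hvc.trans (by gcongr)⟩
    refine exists_shifted_partition hpos hsymm h0 htop hM N ?_ ?_
    · simpa only [mul_assoc] using hN
    · intro z _
      simpa only [mul_assoc] using (hN' z).trans (Nat.mul_le_mul_left 11 h𝒬)

end Carving

section Mixtures

variable {α ι κ : Type*}

lemma toOuterMeasure_le_one (μ : PMF α) (E : Set α) : μ.toOuterMeasure E ≤ 1 := by
  rw [PMF.toOuterMeasure_apply, ← μ.tsum_coe]
  exact ENNReal.tsum_le_tsum fun a => Set.indicator_le_self _ _ a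

lemma bind_toOuterMeasure_le (p : PMF ι) (K : ι → PMF α) (E : Set α) {y : ℝ≥0∞}
    (h : ∀ i, (K i).toOuterMeasure E ≤ y) : (p.bind K).toOuterMeasure E ≤ y := by
  rw [PMF.toOuterMeasure_bind_apply]
  calc _ ≤ ∑' i, p i * y := ENNReal.tsum_le_tsum fun i => by gcongr; exact h i
    _ = y := by rw [ENNReal.tsum_mul_right, p.tsum_coe, one_mul]

lemma bind_map_toOuterMeasure_le_left (p : PMF ι) (q : PMF κ) (F : ι → κ → α) {E : Set α}
    {A : Set ι} (h : ∀ a b, F a b ∈ E → a ∈ A) :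
    (p.bind fun a => q.map (F a)).toOuterMeasure E ≤ p.toOuterMeasure A := by
  rw [PMF.toOuterMeasure_bind_apply, PMF.toOuterMeasure_apply]
  refine ENNReal.tsum_le_tsum fun a => ?_
  by_cases ha : a ∈ A
  · rw [Set.indicator_of_mem ha]
    exact mul_le_of_le_one_right' (toOuterMeasure_le_one _ _)
  · have : F a ⁻¹' E = ∅ := Set.eq_empty_of_forall_notMem fun b hb => ha (h a b hb)
    rw [PMF.toOuterMeasure_map_apply, this, measure_empty, mul_zero]
    exact bot_le

lemma bind_map_toOuterMeasure_le_right (p : PMF ι) (q : PMF κ) (F : ι → κ → α) {E : Set α}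
    {A : Set κ} (h : ∀ a b, F a b ∈ E → b ∈ A) :
    (p.bind fun a => q.map (F a)).toOuterMeasure E ≤ q.toOuterMeasure A := by
  refine bind_toOuterMeasure_le _ _ _ fun a => ?_
  rw [PMF.toOuterMeasure_map_apply]
  exact q.toOuterMeasure.mono fun b hb => h a b hb

/-- The truncated geometric distribution. -/
lemma exists_truncated_geometric {β : ℝ} (hβ0 : 0 < β) (hβ1 : β < 1) {M : ℕ} (hM : 0 < M) :
    ∃ p : PMF (Fin M), ∀ (K : Fin M → PMF α) (E : Set α) (x : ℝ),
      (∀ c : ℕ → ℝ, (∀ J : Fin M, c J = ((K J).toOuterMeasure E).toReal) →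
        ∑ J ∈ Finset.range M, (1 - β) * β ^ J / (1 - β ^ M) * c J ≤ x) →
      (p.bind K).toOuterMeasure E ≤ ENNReal.ofReal x := by
  have hδ : 0 < 1 - β ^ M := by
    have := pow_lt_one₀ hβ0.le hβ1 hM.ne'
    linarith
  have hβ' : 0 < 1 - β := by linarith
  have hsum : ∑ J : Fin M, ENNReal.ofReal ((1 - β) * β ^ (J : ℕ) / (1 - β ^ M)) = 1 := by
    rw [← ENNReal.ofReal_sum_of_nonneg fun J _ => by positivity,
      ← Finset.sum_range (fun J => (1 - β) * β ^ J / (1 - β ^ M)), ← Finset.sum_div,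
      ← Finset.mul_sum, mul_comm, geom_sum_mul_neg, div_self hδ.ne', ENNReal.ofReal_one]
  refine ⟨PMF.ofFintype _ hsum, fun K E x hx => ?_⟩
  have h := hx (fun J => if hJ : J < M then ((K ⟨J, hJ⟩).toOuterMeasure E).toReal else 0)
    fun J => by simp
  rw [Finset.sum_range] at h
  rw [PMF.toOuterMeasure_bind_apply, tsum_fintype]
  refine le_trans (le_of_eq ?_) (ENNReal.ofReal_le_ofReal h)
  rw [ENNReal.ofReal_sum_of_nonneg fun J _ => by
    have : 0 ≤ ((K J).toOuterMeasure E).toReal := ENNReal.toReal_nonneg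
    simp only [Fin.is_lt, dite_true]
    positivity]
  refine Finset.sum_congr rfl fun J _ => ?_
  simp only [Fin.is_lt, dite_true, PMF.ofFintype_apply]
  rw [ENNReal.ofReal_mul (by positivity), ENNReal.ofReal_toReal]
  exact ((toOuterMeasure_le_one _ _).trans_lt ENNReal.one_lt_top).ne

lemma cutBound_nonneg {β : ℝ} (hβ0 : 0 < β) (hβ1 : β < 1) {m M g : ℕ} {b : ℝ} (hb : 0 ≤ b)
    (X : Finset ℕ) : 0 ≤ cutBound β m M g b X := by
  have h1 : 0 ≤ 1 - β ^ M := sub_nonneg.2 (pow_le_one₀ hβ0.le hβ1.le)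
  have h2 : 0 ≤ 1 - β := by linarith
  have h3 : 0 ≤ potential (2 * β / (1 + β)) X := potential_nonneg (by positivity) (by
    rw [div_le_one (by linarith)]
    linarith) X
  unfold cutBound
  positivity

end Mixtures

section Induction

variable {G : SimpleGraph V} {w : V → V → ℝ} {U S T : Set V} {𝒮 : Set (Set V)} {z v : V}

open Classical in
/-- Glue clusterings of `S` and of its complement. -/
noncomputable def glue (S : Set V) (f₁ f₂ : V → ℕ) (v : V) : ℕ :=
  if v ∈ S then 2 * f₁ v else 2 * f₂ v + 1

lemma glue_of_mem {f₁ f₂ : V → ℕ} (h : v ∈ S) : glue S f₁ f₂ v = 2 * f₁ v := if_pos h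

lemma glue_of_notMem {f₁ f₂ : V → ℕ} (h : v ∉ S) : glue S f₁ f₂ v = 2 * f₂ v + 1 := if_neg h

lemma dIn_glue_le {c : ℝ≥0∞} {f₁ f₂ : V → ℕ} (hSU : S ⊆ U)
    (h₁ : ∀ x ∈ S, ∀ y ∈ S, f₁ x = f₁ y → dIn G w {v | v ∈ S ∧ f₁ v = f₁ x} x y ≤ c)
    (h₂ : ∀ x ∈ U \ S, ∀ y ∈ U \ S, f₂ x = f₂ y →
      dIn G w {v | v ∈ U \ S ∧ f₂ v = f₂ x} x y ≤ c) :
    ∀ x ∈ U, ∀ y ∈ U, glue S f₁ f₂ x = glue S f₁ f₂ y →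
      dIn G w {v | v ∈ U ∧ glue S f₁ f₂ v = glue S f₁ f₂ x} x y ≤ c := by
  intro x hx y hy hxy
  by_cases hxS : x ∈ S <;> by_cases hyS : y ∈ S
  · rw [glue_of_mem hxS, glue_of_mem hyS] at hxy
    refine (dIn_mono fun v hv => ?_).trans (h₁ x hxS y hyS (by omega))
    exact ⟨hSU hv.1, by rw [glue_of_mem hv.1, glue_of_mem hxS, hv.2]⟩
  · rw [glue_of_mem hxS, glue_of_notMem hyS] at hxy
    omega
  · rw [glue_of_notMem hxS, glue_of_mem hyS] at hxy
    omega
  · rw [glue_of_notMem hxS, glue_of_notMem hyS] at hxy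
    refine (dIn_mono fun v hv => ?_).trans (h₂ x ⟨hx, hxS⟩ y ⟨hy, hyS⟩ (by omega))
    exact ⟨hv.1.1, by rw [glue_of_notMem hv.1.2, glue_of_notMem hxS, hv.2]⟩

/-- Paths that stay far from `T` survive when a neighbourhood of `T` is removed. -/
lemma dIn_sdiff_le [Finite V] (hpos : ∀ u v, G.Adj u v → 0 < w u v)
    (hsymm : ∀ u v, w u v = w v u) {c : ℝ≥0∞} (hv : dIn G w U z v < ⊤)
    (h : dIn G w U z v + c < dSet G w U z T) :
    dIn G w (U \ {v | v ∈ U ∧ dSet G w U v T ≤ c}) z v ≤ dIn G w U z v := by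
  refine dIn_le_of_local hpos hsymm hv fun u hu => ⟨mem_right_of_dIn_lt_top (hu.trans_lt hv), ?_⟩
  rintro ⟨-, hu'⟩
  exact ((dSet_triangle hpos).trans (add_le_add hu hu')).not_gt h

/-- Paths that stay close to `T` survive in a neighbourhood of `T`. -/
lemma dIn_neighborhood_le [Finite V] (hpos : ∀ u v, G.Adj u v → 0 < w u v)
    (hsymm : ∀ u v, w u v = w v u) {c : ℝ≥0∞} (hv : dIn G w U z v < ⊤)
    (h : dIn G w U z v + dSet G w U z T ≤ c) :
    dIn G w {v | v ∈ U ∧ dSet G w U v T ≤ c} z v ≤ dIn G w U z v := by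
  refine dIn_le_of_local hpos hsymm hv fun u hu => ⟨mem_right_of_dIn_lt_top (hu.trans_lt hv), ?_⟩
  refine (dSet_triangle hpos (y := z)).trans (le_trans ?_ h)
  rw [dIn_comm hsymm]
  gcongr

/-- `X` records (discretised upper bounds for) the distances in `U` from `z` to some of the branch
sets in `𝒮`. -/
def IsRecord (G : SimpleGraph V) (w : V → V → ℝ) (h : ℝ≥0∞) (U : Set V) (𝒮 : Set (Set V)) (z : V)
    (X : Finset ℕ) : Prop :=
  ∃ s : ℕ → Set V, Set.InjOn s X ∧
    ∀ n ∈ X, s n ∈ 𝒮 ∧ ∃ u, dIn G w U z u < n * h ∧ ∃ a ∈ s n, G.Adj u a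

lemma IsRecord.card_lt [Finite V] {h : ℝ≥0∞} {X : Finset ℕ} (hX : IsRecord G w h U 𝒮 z X)
    (hpos : ∀ u v, G.Adj u v → 0 < w u v) (hsymm : ∀ u v, w u v = w v u) {r : ℕ}
    (hG : ¬ HasCliqueMinor G (r + 1)) (hz : z ∈ U) (hU : IsCliqueState G w U 𝒮) :
    X.card < r := by
  classical
  obtain ⟨s, hs, hX⟩ := hX
  rw [← Finset.card_image_of_injOn hs]
  refine hU.card_lt hpos hsymm hG hz (z := z) ?_ ?_
  · intro S hS
    obtain ⟨n, hn, rfl⟩ := Finset.mem_image.1 (Finset.mem_coe.1 hS)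
    exact (hX n hn).1
  · intro S hS
    obtain ⟨n, hn, rfl⟩ := Finset.mem_image.1 hS
    obtain ⟨u, hu, hu'⟩ := (hX n hn).2
    exact ⟨u, hu.trans_le le_top, hu'⟩

lemma IsRecord.sdiff [Finite V] {h c : ℝ≥0∞} {X : Finset ℕ} (hX : IsRecord G w h U 𝒮 z X)
    (hpos : ∀ u v, G.Adj u v → 0 < w u v) (hsymm : ∀ u v, w u v = w v u)
    (hS : S = {v | v ∈ U ∧ dSet G w U v T ≤ c})
    (hfar : ∀ n ∈ X, ∀ d < n * h, d + c < dSet G w U z T) :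
    IsRecord G w h (U \ S) (insert S 𝒮) z X := by
  obtain ⟨s, hs, hX⟩ := hX
  refine ⟨s, hs, fun n hn => ?_⟩
  obtain ⟨h1, u, h2, h3⟩ := hX n hn
  refine ⟨Set.mem_insert_of_mem _ h1, u, ?_, h3⟩
  rw [hS]
  exact (dIn_sdiff_le hpos hsymm (h2.trans_le le_top) (hfar n hn _ h2)).trans_lt h2

lemma IsRecord.insertBelow [Finite V] {h : ℝ≥0∞} {X : Finset ℕ} (hX : IsRecord G w h U 𝒮 z X)
    (hpos : ∀ u v, G.Adj u v → 0 < w u v) (hsymm : ∀ u v, w u v = w v u) (htop : h ≠ ⊤)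
    {D J : ℕ} (hJD : J < D) (hD : dSet G w U z T ≤ D * h)
    (hD' : ∀ n < D, n * h < dSet G w U z T)
    (hS : S = {v | v ∈ U ∧ dSet G w U v T ≤ J * h}) (hS𝒮 : S ∉ 𝒮) :
    IsRecord G w h (U \ S) (insert S 𝒮) z (insertBelow X (D - J)) := by
  classical
  obtain ⟨s, hs, hX⟩ := hX
  have hnat : ∀ n : ℕ, (n : ℝ≥0∞) * h ≠ ⊤ := fun n => ENNReal.mul_ne_top (by simp) htop
  have hne : ∀ n ∈ X.filter (· < D - J), n ≠ D - J := fun n hn =>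
    (Finset.mem_filter.1 hn).2.ne
  have hmem : ∀ n ∈ X.filter (· < D - J), s n ∈ 𝒮 := fun n hn =>
    (hX n (Finset.mem_filter.1 hn).1).1
  refine ⟨Function.update s (D - J) S, ?_, ?_⟩
  · intro a ha b hb hab
    rcases Finset.mem_insert.1 ha with rfl | ha <;> rcases Finset.mem_insert.1 hb with rfl | hb
    · rfl
    · rw [Function.update_self, Function.update_of_ne (hne b hb)] at hab
      exact absurd (hab ▸ hmem b hb) hS𝒮
    · rw [Function.update_self, Function.update_of_ne (hne a ha)] at hab
      exact absurd (hab ▸ hmem a ha) hS𝒮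
    · rw [Function.update_of_ne (hne a ha), Function.update_of_ne (hne b hb)] at hab
      exact hs (Finset.mem_filter.1 ha).1 (Finset.mem_filter.1 hb).1 hab
  · intro n hn
    rcases Finset.mem_insert.1 hn with rfl | hn
    · rw [Function.update_self]
      refine ⟨Set.mem_insert _ _, ?_⟩
      have htau : dSet G w U z T < ⊤ := hD.trans_lt (hnat D).lt_top
      obtain ⟨u, ⟨a, ha, hua⟩, hu, hzu⟩ := exists_adj_of_lt_dSet hpos (hD' J hJD) htau
      rw [← hS] at hzu
      refine ⟨u, ?_, a, by rw [hS]; exact ha, hua⟩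
      have h1 : dIn G w (U \ S) z u ≠ ⊤ := ((le_self_add.trans hzu).trans_lt htau).ne
      have h2 : ((D - J : ℕ) : ℝ≥0∞) * h + J * h = D * h := by
        rw [← add_mul, ← Nat.cast_add, Nat.sub_add_cancel hJD.le]
      refine (ENNReal.add_lt_add_iff_right (hnat J)).1 ?_
      rw [h2]
      exact ((ENNReal.add_lt_add_left h1 hu).trans_le hzu).trans_le hD
    · rw [Function.update_of_ne (hne n hn)]
      obtain ⟨hnX, hnD⟩ := Finset.mem_filter.1 hn
      obtain ⟨h1, u, h2, h3⟩ := hX n hnX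
      refine ⟨Set.mem_insert_of_mem _ h1, u, ?_, h3⟩
      rw [hS]
      refine (dIn_sdiff_le hpos hsymm (h2.trans_le le_top) ?_).trans_lt h2
      refine lt_of_le_of_lt ?_ (hD' (n + J) (by omega))
      push_cast
      rw [add_mul]
      gcongr

end Induction

section Main

variable {G : SimpleGraph V} {w : V → V → ℝ}

lemma exists_clustering [Fintype V] (hpos : ∀ u v, G.Adj u v → 0 < w u v)
    (hsymm : ∀ u v, w u v = w v u) {r : ℕ} (hG : ¬ HasCliqueMinor G (r + 1)) {h : ℝ≥0∞}
    (h0 : h ≠ 0) (htop : h ≠ ⊤) {M m : ℕ} (hM0 : 0 < M) (hr : r = m + 1) {β : ℝ} (hβ0 : 0 < β)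
    (hβ1 : β < 1) (hM : 2 * β ^ M ≤ (2 * β / (1 + β)) ^ M * (1 / 2) ^ m) (U : Set V)
    (𝒮 : Set (Set V)) (hU : IsCliqueState G w U 𝒮) :
    ∃ μ : PMF (V → ℕ),
      (∀ f ∈ μ.support, ∀ x ∈ U, ∀ y ∈ U, f x = f y →
        dIn G w {v | v ∈ U ∧ f v = f x} x y ≤ 6 * M * h) ∧
      ∀ z ∈ U, ∀ g ≤ M, ∀ B : Set V, (∀ v ∈ B, dIn G w U z v ≤ g * h) →
        ∀ X, IsRecord G w h U 𝒮 z X →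
        μ.toOuterMeasure {f | ∃ y ∈ B, f y ≠ f z} ≤ ENNReal.ofReal
          (cutBound β m M g (((11 * r : ℕ) : ℝ) ^ 2 * (2 * g + 1) / M) X) := by
  classical
  induction hn : U.ncard using Nat.strong_induction_on generalizing U 𝒮 with
  | _ n ih =>
  rcases U.eq_empty_or_nonempty with rfl | ⟨t, ht⟩
  · exact ⟨PMF.pure 0, by simp, by simp⟩
  obtain ⟨T, htT, hTU, hT⟩ := hU.exists_carving hpos hsymm hG ht h0 htop hM0
  let S : ℕ → Set V := fun J => {v | v ∈ U ∧ dSet G w U v T ≤ J * h}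
  have htS : ∀ J, t ∈ S J := fun J => ⟨ht, by rw [dSet_self ht htT]; exact bot_le⟩
  have hSU : ∀ J, S J ⊆ U := fun J v hv => hv.1
  have hS𝒮 : ∀ J, S J ∉ 𝒮 := fun J hJ =>
    Set.disjoint_left.1 (hU.disjoint _ hJ) (htS J) ht
  choose hstate ν hνd hνc using fun J : Fin M => hT J J.2.le (S J) rfl
  have hlt : ∀ J, (U \ S J).ncard < n := fun J => by
    rw [← hn]
    exact Set.ncard_lt_ncard ⟨Set.sdiff_subset, fun h => (h ht).2 (htS J)⟩
  choose μ hμd hμc using fun J : Fin M => ih _ (hlt J) _ _ (hstate J) rfl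
  obtain ⟨p, hp⟩ := exists_truncated_geometric (α := V → ℕ) hβ0 hβ1 hM0
  let K : Fin M → PMF (V → ℕ) := fun J => (ν J).bind fun f₁ => (μ J).map (glue (S J) f₁)
  refine ⟨p.bind K, fun f hf => ?_, fun z hz g hg B hB X hX => ?_⟩
  · obtain ⟨J, -, hf⟩ := (PMF.mem_support_bind_iff _ _ _).1 hf
    obtain ⟨f₁, hf₁, hf⟩ := (PMF.mem_support_bind_iff _ _ _).1 hf
    obtain ⟨f₂, hf₂, rfl⟩ := (PMF.mem_support_map_iff _ _ _).1 hf
    exact dIn_glue_le (hSU J) (hνd J f₁ hf₁) (hμd J f₂ hf₂)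
  have hb : 0 ≤ ((11 * r : ℕ) : ℝ) ^ 2 * (2 * g + 1) / M := by positivity
  set b := ((11 * r : ℕ) : ℝ) ^ 2 * (2 * g + 1) / M
  have hnat : ∀ n : ℕ, (n : ℝ≥0∞) * h < ⊤ := fun n =>
    (ENNReal.mul_ne_top (by simp) htop).lt_top
  have hfar : ∀ (J : Fin M) (Y : Finset ℕ), z ∉ S J →
      (∀ v ∈ B, dIn G w U z v + J * h < dSet G w U z T) →
      IsRecord G w h (U \ S J) (insert (S J) 𝒮) z Y →
      (K J).toOuterMeasure {f | ∃ y ∈ B, f y ≠ f z} ≤ ENNReal.ofReal (cutBound β m M g b Y) := by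
    intro J Y hzJ hBJ hY
    have hB' : ∀ v ∈ B, dIn G w (U \ S J) z v ≤ g * h := fun v hv =>
      (dIn_sdiff_le hpos hsymm ((hB v hv).trans_lt (hnat g)) (hBJ v hv)).trans (hB v hv)
    refine (bind_map_toOuterMeasure_le_right _ _ _ ?_).trans
      (hμc J z ⟨hz, hzJ⟩ g hg B hB' Y hY)
    rintro f₁ f₂ ⟨y, hyB, hy⟩
    have hyJ : y ∉ S J := (mem_right_of_dIn_lt_top ((hB' y hyB).trans_lt (hnat g))).2
    rw [glue_of_notMem hyJ, glue_of_notMem hzJ] at hy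
    exact ⟨y, hyB, fun h => hy (by rw [h])⟩
  by_cases htau : dSet G w U z T = ⊤
  · refine bind_toOuterMeasure_le _ _ _ fun J => hfar J X ?_ ?_ ?_
    · rintro ⟨-, hzJ⟩
      rw [htau] at hzJ
      exact hzJ.not_gt (hnat J)
    · intro v hv
      rw [htau]
      exact ENNReal.add_lt_top.2 ⟨(hB v hv).trans_lt (hnat g), hnat J⟩
    · refine hX.sdiff hpos hsymm rfl fun n _ d hd => ?_
      rw [htau]
      exact ENNReal.add_lt_top.2 ⟨hd.trans (hnat n), hnat J⟩
  have hex : ∃ D : ℕ, dSet G w U z T ≤ D * h := by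
    obtain ⟨D, hD⟩ := ENNReal.exists_nat_mul_gt h0 htau
    exact ⟨D, hD.le⟩
  obtain ⟨D, hD, hD'⟩ : ∃ D : ℕ, dSet G w U z T ≤ D * h ∧ ∀ n < D, n * h < dSet G w U z T :=
    ⟨Nat.find hex, Nat.find_spec hex, fun n hn => not_le.1 (Nat.find_min hex hn)⟩
  have hXm : X.card ≤ m := by
    have := hX.card_lt hpos hsymm hG hz hU
    omega
  refine hp K _ _ fun c hc => cutBound_step hβ0 hβ1 hM0 hXm hM hb D c ?_ ?_ ?_
  · intro J hJ hDJ
    rw [hc ⟨J, hJ⟩]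
    refine ENNReal.toReal_le_of_le_ofReal hb ?_
    have hadd : (g : ℝ≥0∞) * h + D * h ≤ J * h := by
      rw [← add_mul]
      gcongr
      exact_mod_cast (add_comm g D).trans_le hDJ
    have hzJ : z ∈ S J := ⟨hz, hD.trans (le_add_self.trans hadd)⟩
    have hB' : ∀ v ∈ B, dIn G w (S J) z v ≤ g * h := fun v hv =>
      (dIn_neighborhood_le hpos hsymm ((hB v hv).trans_lt (hnat g))
        ((add_le_add (hB v hv) hD).trans hadd)).trans (hB v hv)
    refine (bind_map_toOuterMeasure_le_left _ _ _ ?_).trans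
      (hνc ⟨J, hJ⟩ z hzJ g hg B hB')
    rintro f₁ f₂ ⟨y, hyB, hy⟩
    have hyJ : y ∈ S J := mem_right_of_dIn_lt_top ((hB' y hyB).trans_lt (hnat g))
    rw [glue_of_mem hyJ, glue_of_mem hzJ] at hy
    exact ⟨y, hyB, fun h => hy (by rw [h])⟩
  · intro J hJ hJD
    rw [hc ⟨J, hJ⟩]
    refine ENNReal.toReal_le_of_le_ofReal (cutBound_nonneg hβ0 hβ1 hb _) ?_
    refine hfar ⟨J, hJ⟩ _ ?_ ?_ (hX.insertBelow hpos hsymm htop (by omega) hD hD' rfl (hS𝒮 J))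
    · rintro ⟨-, hzJ⟩
      exact hzJ.not_gt (hD' J (by omega))
    · intro v hv
      refine lt_of_le_of_lt ?_ (hD' (g + J) (by omega))
      push_cast
      rw [add_mul]
      gcongr
      exact hB v hv
  · intro J hJ
    rw [hc ⟨J, hJ⟩]
    exact ENNReal.toReal_le_of_le_ofReal zero_le_one (by
      simpa using toOuterMeasure_le_one _ _)

end Main

section Estimates

lemma cutBound_empty_le {β : ℝ} (hβ : 1 / 2 ≤ β) (hβ1 : β < 1) {m M g : ℕ} (b : ℝ)
    (hM : 2 * β ^ M ≤ (2 * β / (1 + β)) ^ M * (1 / 2) ^ m) (hg : g * (1 - β) ≤ 1) :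
    cutBound β m M g b ∅ ≤ b + 14 * (g * (1 - β)) := by
  have hβ0 : 0 < β := by linarith
  have h1β : 0 < 1 - β := by linarith
  unfold cutBound
  have hqg : 1 - 2 / 3 * (1 - β) ≤ 2 * β / (1 + β) := by
    rw [le_div_iff₀ (by linarith)]
    nlinarith
  set q := 2 * β / (1 + β) with hq
  have hq0 : 0 < q := by positivity
  have hq1 : q < 1 := by
    rw [hq, div_lt_one (by linarith)]
    linarith
  rw [potential_empty hq0.le hq1]
  have hpow : 1 / 3 ≤ q ^ g := by
    have := one_add_mul_le_pow (a := q - 1) (by linarith) g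
    rw [add_sub_cancel] at this
    have h2 : (g : ℝ) * (2 / 3 * (1 - β)) ≥ g * (1 - q) := by gcongr; linarith
    linarith
  have hδ0 : 0 < β ^ M := by positivity
  have hδ : β ^ M ≤ 1 / 2 := by
    have h1 : q ^ M * (1 / 2) ^ m ≤ 1 :=
      mul_le_one₀ (pow_le_one₀ hq0.le hq1.le) (by positivity)
        (pow_le_one₀ (by norm_num) (by norm_num))
    linarith
  have hκ : 0 < q ^ (M + g) * (1 / 2 : ℝ) ^ m := by positivity
  have key : β ^ M / (1 - β ^ M) * (2 / (q ^ (M + g) * (1 / 2) ^ m)) ≤ 6 := by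
    rw [div_mul_div_comm, div_le_iff₀ (mul_pos (by linarith) hκ), pow_add]
    have h2 : 0 < q ^ M * (1 / 2 : ℝ) ^ m := by positivity
    calc β ^ M * 2 ≤ 6 * (1 / 2 * (q ^ M * (1 / 2) ^ m * (1 / 3))) := by linarith
      _ ≤ 6 * ((1 - β ^ M) * (q ^ M * (1 / 2) ^ m * q ^ g)) := by
        gcongr <;> linarith
      _ = _ := by ring
  have h3 : 0 ≤ 2 * g * (1 - β) := by positivity
  nlinarith [mul_le_mul_of_nonneg_left key h3]

lemma two_mul_pow_le {m M : ℕ} (hM : 8 * (m + 1) ≤ M) {β : ℝ}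
    (hβ : β = 1 - 4 * (m + 1 : ℕ) / M) :
    2 * β ^ M ≤ (2 * β / (1 + β)) ^ M * (1 / 2) ^ m := by
  have hM0 : (0 : ℝ) < M := by
    have : 0 < M := by omega
    exact_mod_cast this
  have hM' : (8 * (m + 1 : ℕ) : ℝ) ≤ M := by exact_mod_cast hM
  have hp : 4 * (m + 1 : ℕ) / (M : ℝ) ≤ 1 / 2 := by
    rw [div_le_iff₀ hM0]
    linarith
  have hβ0 : 1 / 2 ≤ β := by linarith
  have hq : β = 2 * β / (1 + β) * ((1 + β) / 2) := by
    field_simp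
  have hexp : ((1 + β) / 2) ^ M ≤ (1 / 2) ^ (m + 1) := by
    have h1 : (1 + β) / 2 ≤ Real.exp (-(2 * (m + 1 : ℕ) / M)) := by
      refine le_trans (le_of_eq ?_) (Real.add_one_le_exp _)
      rw [hβ]
      ring
    have h2 : Real.exp (-2) ≤ 1 / 2 := by
      rw [Real.exp_neg, one_div]
      refine inv_anti₀ (by norm_num) ?_
      linarith [Real.add_one_le_exp (2 : ℝ)]
    calc _ ≤ Real.exp (-(2 * (m + 1 : ℕ) / M)) ^ M := by gcongr
      _ = Real.exp (-2) ^ (m + 1) := by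
        rw [← Real.exp_nat_mul, ← Real.exp_nat_mul]
        congr 1
        field_simp
      _ ≤ _ := by gcongr
  calc 2 * β ^ M = 2 * ((2 * β / (1 + β)) ^ M * ((1 + β) / 2) ^ M) := by rw [← mul_pow, ← hq]
    _ ≤ 2 * ((2 * β / (1 + β)) ^ M * (1 / 2) ^ (m + 1)) := by gcongr
    _ = _ := by ring

lemma exists_pos_le_weight {V : Type*} [Finite V] {G : SimpleGraph V} {w : V → V → ℝ}
    (hpos : ∀ u v, G.Adj u v → 0 < w u v) : ∃ ε > 0, ∀ u v, G.Adj u v → ε ≤ w u v := by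
  rcases isEmpty_or_nonempty {p : V × V // G.Adj p.1 p.2} with h | h
  · exact ⟨1, one_pos, fun u v huv => (h.false ⟨(u, v), huv⟩).elim⟩
  · obtain ⟨p, hp⟩ := Finite.exists_min fun p : {p : V × V // G.Adj p.1 p.2} => w p.1.1 p.1.2
    exact ⟨_, hpos _ _ p.2, fun u v huv => hp ⟨(u, v), huv⟩⟩

lemma eq_of_dIn_lt {V : Type*} {G : SimpleGraph V} {w : V → V → ℝ} {s : Set V} {x y : V} {ε : ℝ}
    (hpos : ∀ u v, G.Adj u v → 0 < w u v) (hε : ∀ u v, G.Adj u v → ε ≤ w u v)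
    (h : dIn G w s x y < ENNReal.ofReal ε) : x = y := by
  refine of_not_not fun hxy => h.not_ge (le_iInf fun p => ENNReal.ofReal_le_ofReal ?_)
  obtain ⟨p, -⟩ := p
  cases p with
  | nil => exact absurd rfl hxy
  | cons huv p =>
    rw [walkWeight_cons]
    linarith [hε _ _ huv, walkWeight_nonneg hpos p]

end Estimates

/-- Lemma 5.5 / `lem:strong-cut-prob`.
There is a universal constant `C` such that: for every `r ≥ 1`, every finite
edge-weighted graph `G` excluding `K_{r+1}` as a minor and every `Δ > 0` there is a
distribution over partitions of `V` (encoded by cluster-labelling functions `f : V → ℕ`)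
whose clusters have strong diameter at most `Δ`, such that for every vertex `z` and
every `0 ≤ γ ≤ 1/r²`, the probability that the ball `B_G(z, γΔ)` is cut is at most
`C·γ·r²`. -/
theorem strong_partition_cut_probability :
    ∃ C : ℝ, 0 < C ∧
      ∀ (r : ℕ), 1 ≤ r →
      ∀ (V : Type) (_ : Fintype V) (G : SimpleGraph V) (w : V → V → ℝ),
        (∀ u v, G.Adj u v → 0 < w u v) → (∀ u v, w u v = w v u) →
        ¬ HasCliqueMinor G (r + 1) →
        ∀ Δ : ℝ, 0 < Δ →
        ∃ μ : PMF (V → ℕ),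
          (∀ f ∈ μ.support, ∀ x y : V, f x = f y →
            dIn G w {v | f v = f x} x y ≤ ENNReal.ofReal Δ) ∧
          ∀ (z : V) (γ : ℝ), 0 ≤ γ → γ ≤ 1 / (r : ℝ)^2 →
            μ.toOuterMeasure {f | ¬ gball G w z (γ * Δ) ⊆ {y | f y = f z}} ≤
              ENNReal.ofReal (C * γ * (r : ℝ)^2) := by
  refine ⟨5100, by norm_num, fun r hr V _ G w hpos hsymm hG Δ hΔ => ?_⟩
  obtain ⟨m, rfl⟩ : ∃ m, r = m + 1 := ⟨r - 1, by omega⟩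
  obtain ⟨ε, hε0, hε⟩ := exists_pos_le_weight hpos
  obtain ⟨M, hM1, hM2⟩ : ∃ M : ℕ, 8 * (m + 1) ≤ M ∧ Δ / (6 * ε) < M := by
    obtain ⟨M, hM⟩ := exists_nat_gt (Δ / (6 * ε))
    exact ⟨max (8 * (m + 1)) M, le_max_left _ _, hM.trans_le (by push_cast; exact le_max_right _ _)⟩
  have hM0 : 0 < M := by omega
  have hM0' : (0 : ℝ) < M := by exact_mod_cast hM0
  set R : ℝ := ((m + 1 : ℕ) : ℝ) with hR
  have hR1 : 1 ≤ R := by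
    rw [hR]
    exact_mod_cast hr
  have hM1' : 8 * R ≤ M := by
    rw [hR]
    exact_mod_cast hM1
  obtain ⟨β, hβ⟩ : ∃ β : ℝ, β = 1 - 4 * R / M := ⟨_, rfl⟩
  have hp0 : 0 < 4 * R / M := by positivity
  have hp1 : 4 * R / M ≤ 1 / 2 := by
    rw [div_le_iff₀ hM0']
    linarith
  have hβM := two_mul_pow_le hM1 hβ
  obtain ⟨μ, hd, hc⟩ := exists_clustering hpos hsymm hG (h := ENNReal.ofReal (Δ / (6 * M)))
    (by simpa using by positivity) ENNReal.ofReal_ne_top hM0 rfl (by linarith) (by linarith)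
    hβM Set.univ ∅ ⟨by simp, by simp, by simp, by simp⟩
  refine ⟨μ, fun f hf x y hxy => ?_, fun z γ hγ _ => ?_⟩
  · have h6 : 6 * (M : ℝ≥0∞) * ENNReal.ofReal (Δ / (6 * M)) = ENNReal.ofReal Δ := by
      have : (6 * (M : ℝ≥0∞)) = ENNReal.ofReal (6 * M) := by
        rw [ENNReal.ofReal_mul (by norm_num), ENNReal.ofReal_natCast]
        norm_num
      rw [this, ← ENNReal.ofReal_mul (by positivity)]
      congr 1
      field_simp
    rw [← h6]
    refine (dIn_mono fun v hv => ?_).trans (hd f hf x (Set.mem_univ x) y (Set.mem_univ y) hxy)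
    exact hv.2
  have hevent : {f : V → ℕ | ¬ gball G w z (γ * Δ) ⊆ {y | f y = f z}} =
      {f | ∃ y ∈ gball G w z (γ * Δ), f y ≠ f z} := by
    ext f
    simp [Set.subset_def]
  rw [hevent]
  by_cases hbig : 1 ≤ 5100 * γ * R ^ 2
  · refine (toOuterMeasure_le_one _ _).trans ?_
    rw [← ENNReal.ofReal_one]
    exact ENNReal.ofReal_le_ofReal hbig
  push Not at hbig
  rcases lt_or_ge (γ * Δ) ε with hsmall | hlarge
  · have : {f : V → ℕ | ∃ y ∈ gball G w z (γ * Δ), f y ≠ f z} = ∅ := by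
      refine Set.eq_empty_of_forall_notMem ?_
      rintro f ⟨y, hy, hyz⟩
      have : z = y := eq_of_dIn_lt hpos hε
        (lt_of_le_of_lt hy ((ENNReal.ofReal_lt_ofReal_iff hε0).2 hsmall))
      exact hyz (by rw [this])
    rw [this, measure_empty]
    exact bot_le
  have hMγ : 1 < 6 * M * γ := by
    rw [div_lt_iff₀ (by positivity)] at hM2
    have : 1 * Δ < 6 * M * γ * Δ := by nlinarith
    exact lt_of_mul_lt_mul_right this hΔ.le
  set g := ⌈6 * M * γ⌉₊ with hg
  have hg1 : 6 * M * γ ≤ g := Nat.le_ceil _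
  have hg2 : (g : ℝ) ≤ 12 * M * γ := by
    have := Nat.ceil_lt_add_one (a := 6 * M * γ) (by positivity)
    linarith
  have hγR : 5100 * γ * R < 1 := by nlinarith
  have hγ1 : 5100 * γ < 1 := by nlinarith
  have hgM : g ≤ M := by
    have : (g : ℝ) ≤ M := by nlinarith
    exact_mod_cast this
  have hgp : g * (1 - β) ≤ 48 * R * γ := by
    rw [hβ, _root_.sub_sub_cancel]
    calc _ ≤ 12 * M * γ * (4 * R / M) := by gcongr
      _ = _ := by
        field_simp
        ring
  refine (hc z (Set.mem_univ z) g hgM _ (fun v hv => le_trans hv ?_) ∅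
    ⟨fun _ => ∅, by simp, by simp⟩).trans (ENNReal.ofReal_le_ofReal ?_)
  · rw [← ENNReal.ofReal_natCast, ← ENNReal.ofReal_mul (by positivity)]
    refine ENNReal.ofReal_le_ofReal ?_
    calc γ * Δ = 6 * M * γ * (Δ / (6 * M)) := by field_simp
      _ ≤ _ := by gcongr
  · refine (cutBound_empty_le (by linarith) (by linarith) _ hβM (by linarith)).trans ?_
    have hb : ((11 * (m + 1) : ℕ) : ℝ) ^ 2 * (2 * g + 1) / M ≤ 4356 * γ * R ^ 2 := by
      have h11 : ((11 * (m + 1) : ℕ) : ℝ) = 11 * R := by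
        rw [hR, Nat.cast_mul]
        norm_num
      rw [h11, div_le_iff₀ hM0']
      calc (11 * R) ^ 2 * (2 * g + 1) ≤ (11 * R) ^ 2 * (36 * M * γ) := by
            gcongr
            linarith
        _ = _ := by ring
    have hγ2 : 0 ≤ γ * R ^ 2 := by positivity
    have : R * γ ≤ γ * R ^ 2 := by
      nlinarith [mul_nonneg (mul_nonneg hγ (zero_le_one.trans hR1)) (sub_nonneg.2 hR1)]
    linarith

end KPRpaper
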